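/- arXiv:2212.13803 — 9 statements merged into one kernel-verified Lean document; each statement's English description precedes it below -/
import Mathlib

section
/- Let B be a generalized Bratteli diagram of bounded size equipped with the left-to-right order. Then the set X_max of infinite maximal paths and the set X_min of infinite minimal paths are both countably infinite. -/
open Set

/-- A generalized Bratteli diagram of *bounded size* with data `(t n, L n)`:
every vertex level `V n` is identified with `ℤ`; `E n` is the set of edges between
level `n` and level `n+1`; every edge with range `v` has its source in
`{v - t n, …, v + t n}`; there are at most `L n` edges with range `v`; and the
extreme edge sets `E(v - t n, v)` and `E(v + t n, v)` are nonempty. -/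
structure BddGBD where
  /-- the edges between level `n` and level `n + 1` -/
  E : ℕ → Type
  countE : ∀ n, Countable (E n)
  /-- the source of an edge, a vertex of level `n` (identified with `ℤ`) -/
  src : (n : ℕ) → E n → ℤ
  /-- the range of an edge, a vertex of level `n + 1` (identified with `ℤ`) -/
  rng : (n : ℕ) → E n → ℤ
  src_surj : ∀ (n : ℕ) (v : ℤ), ∃ e : E n, src n e = v
  rng_surj : ∀ (n : ℕ) (v : ℤ), ∃ e : E n, rng n e = v
  rng_fin : ∀ (n : ℕ) (v : ℤ), {e : E n | rng n e = v}.Finite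
  /-- bounded size data: the slant bound -/
  t : ℕ → ℕ
  /-- bounded size data: the bound on the number of incoming edges -/
  L : ℕ → ℕ
  src_mem : ∀ (n : ℕ) (e : E n), rng n e - t n ≤ src n e ∧ src n e ≤ rng n e + t n
  card_le : ∀ (n : ℕ) (v : ℤ), Nat.card {e : E n // rng n e = v} ≤ L n
  exists_rightmost : ∀ (n : ℕ) (v : ℤ), ∃ e : E n, rng n e = v ∧ src n e = v + t n
  exists_leftmost : ∀ (n : ℕ) (v : ℤ), ∃ e : E n, rng n e = v ∧ src n e = v - t n

namespace BddGBD

variable (B : BddGBD)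

/-- The path space `X_B`: infinite sequences of composable edges. -/
def Path := { x : (n : ℕ) → B.E n // ∀ n, B.src (n + 1) (x (n + 1)) = B.rng n (x n) }

/-- The topology on the path space, generated by cylinder sets: the topology induced
from the product of the discrete topologies on the edge sets. -/
instance : TopologicalSpace B.Path :=
  TopologicalSpace.induced (fun x : B.Path => x.1)
    (@Pi.topologicalSpace ℕ (fun n => B.E n) (fun _ => ⊥))

/-- The Borel σ-algebra on the path space. -/
instance : MeasurableSpace B.Path := borel B.Path

/-- A finite path from level `0` to level `n + 1` (a sequence of `n + 1` composable edges). -/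
def FinPath (n : ℕ) :=
  { p : (i : Fin (n + 1)) → B.E i //
    ∀ i : Fin n, B.src (i.1 + 1) (p i.succ) = B.rng i.1 (p i.castSucc) }

/-- The range of a finite path: a vertex of level `n + 1`. -/
def FinPath.out {n : ℕ} (p : B.FinPath n) : ℤ := B.rng n (p.1 (Fin.last n))

/-- The source of a finite path: a vertex of level `0`. -/
def FinPath.start {n : ℕ} (p : B.FinPath n) : ℤ := B.src 0 (p.1 ⟨0, Nat.succ_pos n⟩)

/-- The cylinder set of a finite path. -/
def cyl {n : ℕ} (p : B.FinPath n) : Set B.Path :=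
  { x : B.Path | ∀ i : Fin (n + 1), x.1 i.1 = p.1 i }

/-- Two infinite paths are tail equivalent if they eventually agree. -/
def TailEquiv (x y : B.Path) : Prop := ∃ N : ℕ, ∀ n, N ≤ n → x.1 n = y.1 n

/-- An order on a Bratteli diagram: a partial order on each edge set such that two edges
are comparable iff they have the same range, and which is linear on each set `r⁻¹(v)`. -/
structure EdgeOrder where
  le : (n : ℕ) → B.E n → B.E n → Prop
  le_rng : ∀ n e f, le n e f → B.rng n e = B.rng n f
  le_refl : ∀ n e, le n e e
  le_antisymm : ∀ n e f, le n e f → le n f e → e = f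
  le_trans : ∀ n e f g, le n e f → le n f g → le n e g
  le_total : ∀ n e f, B.rng n e = B.rng n f → le n e f ∨ le n f e

/-- The left-to-right order: `e < f` whenever `s(e) < s(f)` (for edges with the same range). -/
def IsLeftToRight (ω : B.EdgeOrder) : Prop :=
  ∀ (n : ℕ) (e f : B.E n), B.rng n e = B.rng n f → B.src n e < B.src n f →
    ω.le n e f ∧ e ≠ f

/-- An edge is maximal if it is the largest element of `r⁻¹(r(e))`. -/
def IsMaxEdge (ω : B.EdgeOrder) (n : ℕ) (e : B.E n) : Prop :=
  ∀ f : B.E n, B.rng n f = B.rng n e → ω.le n f e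

/-- An edge is minimal if it is the smallest element of `r⁻¹(r(e))`. -/
def IsMinEdge (ω : B.EdgeOrder) (n : ℕ) (e : B.E n) : Prop :=
  ∀ f : B.E n, B.rng n f = B.rng n e → ω.le n e f

/-- An infinite path is maximal if all of its edges are maximal. -/
def IsMaxPath (ω : B.EdgeOrder) (x : B.Path) : Prop := ∀ n, B.IsMaxEdge ω n (x.1 n)

/-- An infinite path is minimal if all of its edges are minimal. -/
def IsMinPath (ω : B.EdgeOrder) (x : B.Path) : Prop := ∀ n, B.IsMinEdge ω n (x.1 n)

/-- `f` is the successor of `e` in the linearly ordered set `r⁻¹(r(e))`. -/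
def IsSuccEdge (ω : B.EdgeOrder) (n : ℕ) (e f : B.E n) : Prop :=
  ω.le n e f ∧ e ≠ f ∧ ∀ g : B.E n, ω.le n e g → g ≠ e → ω.le n f g

/-- `y` is the image of `x` under the canonical Vershik map: the first non-maximal edge
`x m` is replaced by its successor, the edges above level `m` are unchanged, and the
initial segment is replaced by the minimal finite path (each of its edges is minimal). -/
def VershikRel (ω : B.EdgeOrder) (x y : B.Path) : Prop :=
  ∃ m : ℕ, (∀ i, i < m → B.IsMaxEdge ω i (x.1 i)) ∧ ¬ B.IsMaxEdge ω m (x.1 m) ∧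
    B.IsSuccEdge ω m (x.1 m) (y.1 m) ∧ (∀ i, m < i → y.1 i = x.1 i) ∧
    ∀ i, i < m → B.IsMinEdge ω i (y.1 i)

/-- The slanting set `Z_w^+`. -/
def Zplus (w : ℤ) : Set B.Path :=
  { x : B.Path | w ≤ B.src 0 (x.1 0) ∧
      ∀ n : ℕ, w + ∑ i ∈ Finset.range (n + 1), (B.t i : ℤ) ≤ B.rng n (x.1 n) }

/-- The slanting set `Z_w^-`. -/
def Zminus (w : ℤ) : Set B.Path :=
  { x : B.Path | B.src 0 (x.1 0) ≤ w ∧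
      ∀ n : ℕ, B.rng n (x.1 n) ≤ w - ∑ i ∈ Finset.range (n + 1), (B.t i : ℤ) }

/-- The set `Y_w^+` of paths starting at `w` through the rightmost possible vertices. -/
def Yplus (w : ℤ) : Set B.Path :=
  { x : B.Path | B.src 0 (x.1 0) = w ∧
      ∀ m : ℕ, B.rng m (x.1 m) = w + ∑ i ∈ Finset.range (m + 1), (B.t i : ℤ) }

/-- The set `Y_w^-` of paths starting at `w` through the leftmost possible vertices. -/
def Yminus (w : ℤ) : Set B.Path :=
  { x : B.Path | B.src 0 (x.1 0) = w ∧
      ∀ m : ℕ, B.rng m (x.1 m) = w - ∑ i ∈ Finset.range (m + 1), (B.t i : ℤ) }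

end BddGBD

theorem aux_max {α : Type} (r : α → α → Prop) (T : Set α) (hne : T.Nonempty) (hf : T.Finite)
    (htr : ∀ a b c, r a b → r b c → r a c) (hrefl : ∀ a, r a a)
    (htot : ∀ a ∈ T, ∀ b ∈ T, r a b ∨ r b a) : ∃ e ∈ T, ∀ f ∈ T, r f e := by
  suffices H : ∀ S : Set α, S.Finite → S ⊆ T → ∃ e ∈ T, ∀ f ∈ S, r f e from H T hf subset_rfl
  intro S hS
  induction S, hS using Set.Finite.induction_on with
  | empty =>
    intro _
    obtain ⟨e, he⟩ := hne
    exact ⟨e, he, by simp⟩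
  | insert ha hs ih =>
    rename_i a s
    intro hT
    obtain ⟨e, he, hmax⟩ := ih (fun x hx => hT (Set.mem_insert_of_mem _ hx))
    have haT : a ∈ T := hT (Set.mem_insert _ _)
    rcases htot a haT e he with h | h
    · refine ⟨e, he, ?_⟩
      intro f hf
      rcases hf with rfl | hf
      · exact h
      · exact hmax f hf
    · refine ⟨a, haT, ?_⟩
      intro f hf
      rcases hf with rfl | hf
      · exact hrefl _
      · exact htr _ _ _ (hmax f hf) h

theorem aux_main (B : BddGBD) (P : (n : ℕ) → B.E n → Prop) (s : ℕ → ℤ)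
    (hex : ∀ n v, ∃ e, B.rng n e = v ∧ P n e)
    (huniq : ∀ n e f, P n e → P n f → B.rng n e = B.rng n f → e = f)
    (hs : ∀ n e, P n e → B.src n e = B.rng n e + s n) :
    {x : B.Path | ∀ n, P n (x.1 n)}.Countable ∧ {x : B.Path | ∀ n, P n (x.1 n)}.Infinite := by
  constructor
  · refine Set.MapsTo.countable_of_injOn (f := fun x : B.Path => B.src 0 (x.1 0))
      (t := Set.univ) (fun _ _ => Set.mem_univ _) ?_ Set.countable_univ
    intro x hx y hy hxy
    have key : ∀ n, B.src n (x.1 n) = B.src n (y.1 n) := by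
      intro n
      induction n with
      | zero => exact hxy
      | succ n ih =>
        rw [x.2, y.2]
        have h1 := hs n _ (hx n)
        have h2 := hs n _ (hy n)
        omega
    apply Subtype.ext
    funext n
    have h1 := hs n _ (hx n)
    have h2 := hs n _ (hy n)
    have h3 := key n
    exact huniq n _ _ (hx n) (hy n) (by omega)
  · choose g hg hP using hex
    have hpath : ∀ w : ℤ, ∀ n : ℕ,
        B.src (n + 1) (g (n + 1) (w - ∑ i ∈ Finset.range (n + 1 + 1), s i)) =
          B.rng n (g n (w - ∑ i ∈ Finset.range (n + 1), s i)) := by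
      intro w n
      rw [hs _ _ (hP _ _), hg, hg, Finset.sum_range_succ _ (n + 1)]
      ring
    let F : ℤ → B.Path := fun w => ⟨fun n => g n (w - ∑ i ∈ Finset.range (n + 1), s i), hpath w⟩
    refine Set.infinite_of_injective_forall_mem (f := F) ?_ (fun w n => hP _ _)
    intro a b hab
    have h : B.rng 0 ((F a).1 0) = B.rng 0 ((F b).1 0) := by rw [hab]
    simp only [F, hg] at h
    omega

/-- For a bounded size generalized Bratteli diagram endowed with the
left-to-right order, the sets `X_max` of infinite maximal paths and `X_min` of infinite
minimal paths are both countably infinite. -/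
theorem Xmax_Xmin_countably_infinite (B : BddGBD) (ω : B.EdgeOrder)
    (hω : B.IsLeftToRight ω) :
    ({x : B.Path | B.IsMaxPath ω x}.Countable ∧ {x : B.Path | B.IsMaxPath ω x}.Infinite) ∧
    ({x : B.Path | B.IsMinPath ω x}.Countable ∧ {x : B.Path | B.IsMinPath ω x}.Infinite) := by
  constructor
  · refine aux_main B (B.IsMaxEdge ω) (fun n => (B.t n : ℤ)) ?_ ?_ ?_
    · intro n v
      obtain ⟨e, he, hm⟩ := aux_max (ω.le n) {e | B.rng n e = v} (B.rng_surj n v) (B.rng_fin n v)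
        (ω.le_trans n) (ω.le_refl n) (fun a ha b hb => ω.le_total n a b (Eq.trans ha (Eq.symm hb)))
      exact ⟨e, he, fun f hf => hm f (Eq.trans hf he)⟩
    · intro n e f he hf h
      exact ω.le_antisymm n e f (hf e h) (he f h.symm)
    · intro n e he
      obtain ⟨f, hf, hf'⟩ := B.exists_rightmost n (B.rng n e)
      have h1 := (B.src_mem n e).2
      by_contra hne
      have h2 := hω n e f hf.symm (by omega)
      exact h2.2 (ω.le_antisymm n e f h2.1 (he f hf))
  · refine aux_main B (B.IsMinEdge ω) (fun n => -(B.t n : ℤ)) ?_ ?_ ?_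
    · intro n v
      obtain ⟨e, he, hm⟩ := aux_max (fun a b => ω.le n b a) {e | B.rng n e = v}
        (B.rng_surj n v) (B.rng_fin n v)
        (fun a b c h h' => ω.le_trans n c b a h' h) (ω.le_refl n)
        (fun a ha b hb => ω.le_total n b a (Eq.trans hb (Eq.symm ha)))
      exact ⟨e, he, fun f hf => hm f (Eq.trans hf he)⟩
    · intro n e f he hf h
      exact ω.le_antisymm n e f (he f h.symm) (hf e h)
    · intro n e he
      obtain ⟨f, hf, hf'⟩ := B.exists_leftmost n (B.rng n e)
      have h1 := (B.src_mem n e).1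
      by_contra hne
      have h2 := hω n f e hf (by omega)
      exact h2.2 (ω.le_antisymm n f e h2.1 (he f hf))
end

section
/- Let B be a generalized Bratteli diagram of bounded size with data (t_n,L_n)_{n≥0} (levels identified with ℤ), endowed with the left-to-right order. Assume that every vertex v∈V_{n+1} has exactly two incoming edges for every n≥0 (i.e., L_n = 2 and this bound is attained), and that there exists N∈ℕ₀ such that t_{N+k} = ∑_{i=N}^{N+k−1} t_i for all k∈ℕ. Then there exists a continuous Vershik map corresponding to the left-to-right order, i.e., a continuous bijection φ_B : X_B → X_B extending the canonical Vershik map. -/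
open Set

namespace BddGBD

variable (B : BddGBD)

theorem aux_pair (ω : B.EdgeOrder) (hω : B.IsLeftToRight ω)
    (hcard : ∀ (n : ℕ) (v : ℤ), Nat.card {e : B.E n // B.rng n e = v} = 2)
    (n : ℕ) (u : ℤ) : ∃ a c : B.E n, a ≠ c ∧ B.rng n a = u ∧ B.rng n c = u ∧
      (∀ e, B.rng n e = u → e = a ∨ e = c) ∧ ω.le n a c ∧
      B.src n a = u - B.t n ∧ B.src n c = u + B.t n := by
  have key : ∃ a c : B.E n, a ≠ c ∧ B.rng n a = u ∧ B.rng n c = u ∧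
      (∀ e, B.rng n e = u → e = a ∨ e = c) ∧ ω.le n a c := by
    obtain ⟨x, y, hxy, hU⟩ := Nat.card_eq_two_iff.1 (hcard n u)
    have hall : ∀ e, B.rng n e = u → e = x.1 ∨ e = y.1 := by
      intro e he
      have : (⟨e, he⟩ : {e : B.E n // B.rng n e = u}) ∈ ({x, y} : Set _) := by
        rw [hU]; trivial
      rcases this with h | h
      · left; exact congrArg Subtype.val h
      · right; exact congrArg Subtype.val h
    have hne : x.1 ≠ y.1 := fun h => hxy (Subtype.ext h)
    rcases ω.le_total n x.1 y.1 (x.2.trans y.2.symm) with h | h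
    · exact ⟨x.1, y.1, hne, x.2, y.2, hall, h⟩
    · exact ⟨y.1, x.1, hne.symm, y.2, x.2, fun e he => (hall e he).symm, h⟩
  obtain ⟨a, c, hne, ha, hc, hall, hle⟩ := key
  refine ⟨a, c, hne, ha, hc, hall, hle, ?_⟩
  have h1 := B.src_mem n a
  have h2 := B.src_mem n c
  obtain ⟨r, hr, hr'⟩ := B.exists_rightmost n u
  obtain ⟨l, hl, hl'⟩ := B.exists_leftmost n u
  rw [ha] at h1
  rw [hc] at h2
  by_cases ht : B.t n = 0
  · simp only [ht] at *
    constructor <;> push_cast at * <;> omega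
  · obtain ⟨h3, h4⟩ := hω n l r (hl.trans hr.symm) (by omega)
    rcases hall l hl with rfl | rfl <;> rcases hall r hr with rfl | rfl
    · exact absurd rfl h4
    · exact ⟨hl', hr'⟩
    · exact absurd (ω.le_antisymm _ _ _ hle h3) h4.symm
    · exact absurd rfl h4

theorem aux_edge (ω : B.EdgeOrder) (hω : B.IsLeftToRight ω)
    (hcard : ∀ (n : ℕ) (v : ℤ), Nat.card {e : B.E n // B.rng n e = v} = 2) :
    ∃ edge : ∀ n, ℤ → Bool → B.E n,
      (∀ n v b, B.src n (edge n v b) = v) ∧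
      (∀ n v b, B.rng n (edge n v b) = v - (if b then (B.t n : ℤ) else - B.t n)) ∧
      (∀ n v b, B.IsMaxEdge ω n (edge n v b) ↔ b = true) ∧
      (∀ n v b, B.IsMinEdge ω n (edge n v b) ↔ b = false) ∧
      (∀ n e, ∃ b, e = edge n (B.src n e) b) ∧
      (∀ n v v', B.rng n (edge n v false) = B.rng n (edge n v' true) →
        B.IsSuccEdge ω n (edge n v false) (edge n v' true)) := by
  choose lo hi hne hlo hhi hall hle slo shi using B.aux_pair ω hω hcard
  have hmax : ∀ n u, B.IsMaxEdge ω n (hi n u) := by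
    intro n u f hf
    rcases hall n u f (hf.trans (hhi n u)) with rfl | rfl
    · exact hle n u
    · exact ω.le_refl _ _
  have hmin : ∀ n u, B.IsMinEdge ω n (lo n u) := by
    intro n u f hf
    rcases hall n u f (hf.trans (hlo n u)) with rfl | rfl
    · exact ω.le_refl _ _
    · exact hle n u
  have hnmax : ∀ n u, ¬ B.IsMaxEdge ω n (lo n u) := fun n u h =>
    hne n u (ω.le_antisymm _ _ _ (hle n u) (h _ ((hhi n u).trans (hlo n u).symm)))
  have hnmin : ∀ n u, ¬ B.IsMinEdge ω n (hi n u) := fun n u h =>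
    hne n u (ω.le_antisymm _ _ _ (hle n u) (h _ ((hlo n u).trans (hhi n u).symm)))
  refine ⟨fun n v b => if b then hi n (v - B.t n) else lo n (v + B.t n), ?_, ?_, ?_, ?_, ?_, ?_⟩
  · intro n v b; cases b <;> simp [slo, shi]
  · intro n v b; cases b <;> simp [hlo, hhi]
  · intro n v b; cases b <;> simp [hmax, hnmax]
  · intro n v b; cases b <;> simp [hmin, hnmin]
  · intro n e
    rcases hall n _ e rfl with h | h
    · refine ⟨false, ?_⟩
      have := slo n (B.rng n e)
      rw [← h] at this
      simp [this, ← h]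
    · refine ⟨true, ?_⟩
      have := shi n (B.rng n e)
      rw [← h] at this
      simp [this, ← h]
  · intro n v v' h
    simp only [if_true, Bool.false_eq_true, if_false, hlo, hhi] at h ⊢
    rw [← h]
    refine ⟨hle _ _, hne _ _, fun g hg hgne => ?_⟩
    rcases hall n (v + B.t n) g ((ω.le_rng _ _ _ hg).symm.trans (hlo _ _)) with h | h
    · exact absurd h hgne
    · rw [h]; exact ω.le_refl _ _

/-- carry of the odometer -/
def carry (b : ℕ → Bool) : ℕ → Bool
  | 0 => true
  | n + 1 => carry b n && b n

/-- borrow of the odometer -/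
def borrow (b : ℕ → Bool) : ℕ → Bool
  | 0 => true
  | n + 1 => borrow b n && !b n

/-- odometer -/
def odo (b : ℕ → Bool) (n : ℕ) : Bool := xor (b n) (carry b n)

/-- inverse odometer -/
def odoInv (b : ℕ → Bool) (n : ℕ) : Bool := xor (b n) (borrow b n)

theorem borrow_odo (b : ℕ → Bool) (n : ℕ) : borrow (odo b) n = carry b n := by
  induction n with
  | zero => rfl
  | succ n ih => simp only [borrow, carry, ih, odo]; cases b n <;> cases carry b n <;> rfl

theorem carry_odoInv (b : ℕ → Bool) (n : ℕ) : carry (odoInv b) n = borrow b n := by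
  induction n with
  | zero => rfl
  | succ n ih => simp only [borrow, carry, ih, odoInv]; cases b n <;> cases borrow b n <;> rfl

theorem odoInv_odo (b : ℕ → Bool) : odoInv (odo b) = b := by
  funext n; simp [odoInv, borrow_odo]; simp [odo]

theorem odo_odoInv (b : ℕ → Bool) : odo (odoInv b) = b := by
  funext n; simp [odo, carry_odoInv]; simp [odoInv]

theorem carry_of (b : ℕ → Bool) (m : ℕ) (h : ∀ i < m, b i = true) : carry b m = true := by
  induction m with
  | zero => rfl
  | succ m ih => simp [carry, h m (by omega), ih (fun i hi => h i (by omega))]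

theorem carry_not (b : ℕ → Bool) (m : ℕ) (h : b m = false) (n : ℕ) (hn : m < n) :
    carry b n = false := by
  induction n, hn using Nat.le_induction with
  | base => simp [carry, h]
  | succ n _ ih => simp [carry, ih]

/-- vertex offsets -/
def off (t : ℕ → ℕ) (b : ℕ → Bool) : ℕ → ℤ
  | 0 => 0
  | n + 1 => off t b n - (if b n then (t n : ℤ) else - t n)

/-- start shift -/
def shift (t : ℕ → ℕ) (N : ℕ) (b : ℕ → Bool) : ℤ :=
  off t b (N + 1) - off t (odo b) (N + 1) + (if carry b (N + 1) then 2 * (t N : ℤ) else 0)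

theorem off_carry (t : ℕ → ℕ) (b : ℕ → Bool) (n : ℕ) (h : carry b n = true) :
    off t b n - off t (odo b) n = -2 * ∑ i ∈ Finset.range n, (t i : ℤ) := by
  induction n with
  | zero => simp [off]
  | succ n ih =>
    simp only [carry, Bool.and_eq_true] at h
    have := ih h.1
    simp only [off, odo, h.1, h.2, Finset.sum_range_succ]
    simp
    linarith

theorem off_const (t : ℕ → ℕ) (b : ℕ → Bool) (m : ℕ) (h : b m = false) (n : ℕ) (hn : m < n) :
    off t b n - off t (odo b) n = off t b (m+1) - off t (odo b) (m+1) := by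
  induction n, hn using Nat.le_induction with
  | base => rfl
  | succ n hn ih =>
    have := carry_not b m h n hn
    rw [← ih]
    simp [off, odo, this]

theorem shift_eq (t : ℕ → ℕ) (N : ℕ)
    (hT : ∀ k : ℕ, 0 < k → t (N + k) = ∑ i ∈ Finset.Ico N (N + k), t i)
    (b : ℕ → Bool) (m : ℕ) (h : b m = false) (h' : ∀ i < m, b i = true) (n : ℕ) (hn : m < n) :
    shift t N b + off t (odo b) n = off t b n := by
  have hc := carry_of b m h'
  have e1 := off_const t b m h n hn
  have e2 := off_carry t b m hc
  have e3 : off t b (m+1) - off t (odo b) (m+1) =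
      off t b m - off t (odo b) m + 2 * (t m : ℤ) := by
    simp [off, odo, h, hc]; ring
  unfold shift
  by_cases hm : m ≤ N
  · have := off_const t b m h (N+1) (by omega)
    rw [carry_not b m h (N+1) (by omega)]
    simp
    linarith
  · have hcN := carry_of b (N+1) (fun i hi => h' i (by omega))
    have e4 := off_carry t b (N+1) hcN
    obtain ⟨k, rfl⟩ : ∃ k, m = N + k := ⟨m - N, by omega⟩
    have e5 : (t (N+k) : ℤ) = ∑ i ∈ Finset.Ico N (N + k), (t i : ℤ) := by
      exact_mod_cast hT k (by omega)
    have e6 := Finset.sum_range_add_sum_Ico (fun i => (t i : ℤ)) (show N ≤ N + k by omega)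
    rw [Finset.sum_range_succ] at e4
    rw [if_pos hcN]
    linarith

theorem continuous_carry (n : ℕ) : Continuous (fun b : ℕ → Bool => carry b n) := by
  induction n with
  | zero => exact continuous_const
  | succ n ih =>
    exact (continuous_of_discreteTopology (f := fun p : Bool × Bool => p.1 && p.2)).comp
      (ih.prodMk (continuous_apply n))

theorem continuous_odo : Continuous odo := by
  refine continuous_pi fun n => ?_
  exact (continuous_of_discreteTopology (f := fun p : Bool × Bool => xor p.1 p.2)).comp
      ((continuous_apply n).prodMk (continuous_carry n))

theorem continuous_off (t : ℕ → ℕ) (n : ℕ) : Continuous (fun b : ℕ → Bool => off t b n) := by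
  induction n with
  | zero => exact continuous_const
  | succ n ih =>
    exact ih.sub ((continuous_of_discreteTopology
      (f := fun p : Bool => if p then (t n : ℤ) else - t n)).comp (continuous_apply n))

theorem continuous_shift (t : ℕ → ℕ) (N : ℕ) : Continuous (shift t N) := by
  have h : Continuous (fun b => if carry b (N + 1) then 2 * (t N : ℤ) else 0) := (continuous_of_discreteTopology
      (f := fun p : Bool => if p then 2 * (t N : ℤ) else 0)).comp
      (continuous_carry (N + 1))
  exact ((continuous_off t (N + 1)).sub
    ((continuous_off t (N + 1)).comp continuous_odo)).add h

end BddGBD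

/-- Let `B` be a bounded size generalized Bratteli diagram with the
left-to-right order, in which every vertex `v ∈ V_{n+1}` has exactly two incoming edges
(`L n = 2` and the bound is attained), and such that there exists `N` with
`t_{N+k} = ∑_{i=N}^{N+k-1} t_i` for all `k ≥ 1`. Then there exists a continuous Vershik
map corresponding to the left-to-right order: a continuous bijection of the path space
extending the canonical Vershik map. -/
theorem exists_continuous_vershik_map (B : BddGBD) (ω : B.EdgeOrder)
    (hω : B.IsLeftToRight ω)
    (hL : ∀ n : ℕ, B.L n = 2)
    (hcard : ∀ (n : ℕ) (v : ℤ), Nat.card {e : B.E n // B.rng n e = v} = 2)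
    (hT : ∃ N : ℕ, ∀ k : ℕ, 0 < k → B.t (N + k) = ∑ i ∈ Finset.Ico N (N + k), B.t i) :
    ∃ φ : B.Path → B.Path, Function.Bijective φ ∧ Continuous φ ∧
      ∀ x : B.Path, ¬ B.IsMaxPath ω x → B.VershikRel ω x (φ x) := by
  classical
  obtain ⟨N, hT⟩ := hT
  obtain ⟨edge, hsrc, hrng, hmax, hmin, hsurj, hsucc⟩ := B.aux_edge ω hω hcard
  let mk : ℤ → (ℕ → Bool) → B.Path := fun w b =>
    ⟨fun n => edge n (w + BddGBD.off B.t b n) (b n), fun n => by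
      rw [hsrc, hrng, BddGBD.off]; ring⟩
  let bits : B.Path → ℕ → Bool := fun x n => decide (B.IsMaxEdge ω n (x.1 n))
  let st : B.Path → ℤ := fun x => B.src 0 (x.1 0)
  have hbits : ∀ w b, bits (mk w b) = b := by
    intro w b
    funext n
    simp [bits, mk, hmax]
  have hst : ∀ w b, st (mk w b) = w := by
    intro w b
    simp [st, mk, hsrc, BddGBD.off]
  have hedge : ∀ (x : B.Path) n, x.1 n = edge n (B.src n (x.1 n)) (bits x n) := by
    intro x n
    obtain ⟨b, hb⟩ := hsurj n (x.1 n)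
    have : bits x n = b := by
      simp only [bits]
      rw [hb, Bool.eq_iff_iff, decide_eq_true_iff]
      exact hmax n _ b
    rw [this]; exact hb
  have hvtx : ∀ (x : B.Path) n, B.src n (x.1 n) = st x + BddGBD.off B.t (bits x) n := by
    intro x n
    induction n with
    | zero => simp [st, BddGBD.off]
    | succ n ih =>
      rw [x.2 n, hedge x n, hrng, ih, BddGBD.off]; ring
  have hx : ∀ x : B.Path, ∀ n, x.1 n = edge n (st x + BddGBD.off B.t (bits x) n) (bits x n) := by
    intro x n
    rw [← hvtx]; exact hedge x n
  have hmk : ∀ x, mk (st x) (bits x) = x := by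
    intro x
    apply Subtype.ext
    funext n
    exact (hx x n).symm
  refine ⟨fun x => mk (st x + BddGBD.shift B.t N (bits x)) (BddGBD.odo (bits x)), ?_, ?_, ?_⟩
  · rw [Function.bijective_iff_has_inverse]
    refine ⟨fun y => mk (st y - BddGBD.shift B.t N (BddGBD.odoInv (bits y)))
      (BddGBD.odoInv (bits y)), ?_, ?_⟩
    · intro x
      simp [hbits, hst, BddGBD.odoInv_odo, hmk]
    · intro x
      simp [hbits, hst, BddGBD.odo_odoInv, hmk]
  · let _ : ∀ n, TopologicalSpace (B.E n) := fun _ => ⊥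
    have _ : ∀ n, DiscreteTopology (B.E n) := fun _ => ⟨rfl⟩
    have hval : Continuous (fun x : B.Path => x.1) := continuous_induced_dom
    have hco : ∀ n, Continuous (fun x : B.Path => x.1 n) := fun n =>
      (continuous_apply n).comp hval
    have hcst : Continuous st :=
      (continuous_of_discreteTopology (f := B.src 0)).comp (hco 0)
    have hcb : Continuous bits := continuous_pi fun n =>
      (continuous_of_discreteTopology (f := fun e => decide (B.IsMaxEdge ω n e))).comp (hco n)
    have hco' : Continuous (fun x => BddGBD.odo (bits x)) := BddGBD.continuous_odo.comp hcb
    refine continuous_induced_rng.2 (continuous_pi fun n => ?_)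
    exact (continuous_of_discreteTopology (f := fun p : ℤ × Bool => edge n p.1 p.2)).comp
      (((hcst.add ((BddGBD.continuous_shift B.t N).comp hcb)).add
        ((BddGBD.continuous_off B.t n).comp hco')).prodMk ((continuous_apply n).comp hco'))
  · intro x hnx
    have hex : ∃ m, bits x m = false := by
      by_contra hcon
      apply hnx
      intro n
      by_contra hn
      exact hcon ⟨n, by simp [bits, hn]⟩
    obtain ⟨m, hm, hlt⟩ : ∃ m, bits x m = false ∧ ∀ i < m, bits x i = true :=
      ⟨Nat.find hex, Nat.find_spec hex, fun i hi => by simpa using Nat.find_min hex hi⟩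
    have hs := BddGBD.shift_eq B.t N hT (bits x) m hm hlt
    have hcm := BddGBD.carry_of _ _ hlt
    refine ⟨m, fun i hi => ?_, ?_, ?_, fun i hi => ?_, fun i hi => ?_⟩
    · simpa [bits] using hlt i hi
    · simpa [bits] using hm
    · rw [hx x m, hm]
      have ho : BddGBD.odo (bits x) m = true := by simp [BddGBD.odo, hm, hcm]
      simp only [mk, ho]
      apply hsucc
      have := hs (m+1) (by omega)
      simp only [BddGBD.off, hm, ho] at this
      rw [hrng, hrng]
      simp at this ⊢
      linarith
    · rw [hx x i]
      have ho : BddGBD.odo (bits x) i = bits x i := by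
        simp [BddGBD.odo, BddGBD.carry_not _ _ hm i hi]
      simp only [mk, ho]
      rw [add_assoc, hs i hi]
    · simp only [mk]
      rw [hmin]
      simp [BddGBD.odo, hlt i hi, BddGBD.carry_of (bits x) i (fun j hj => hlt j (by omega))]
end

section
/- Let B be a generalized Bratteli diagram whose vertex levels are each identified with ℕ. Suppose there exists a level N such that for every n≥N every vertex v∈V_{n+1} has at least two incoming edges e with r(e) < s(e) (edges slanted from right to left). Then B admits an order for which the set of infinite maximal paths and the set of infinite minimal paths are both empty. -/
open Set

/-- A generalized Bratteli diagram whose vertex levels are each identified with `ℕ`. -/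
structure NatGBD where
  /-- the edges between level `n` and level `n + 1` -/
  E : ℕ → Type
  countE : ∀ n, Countable (E n)
  /-- the source of an edge, a vertex of level `n` (identified with `ℕ`) -/
  src : (n : ℕ) → E n → ℕ
  /-- the range of an edge, a vertex of level `n + 1` (identified with `ℕ`) -/
  rng : (n : ℕ) → E n → ℕ
  src_surj : ∀ (n : ℕ) (v : ℕ), ∃ e : E n, src n e = v
  rng_surj : ∀ (n : ℕ) (v : ℕ), ∃ e : E n, rng n e = v
  rng_fin : ∀ (n : ℕ) (v : ℕ), {e : E n | rng n e = v}.Finite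

namespace NatGBD

variable (B : NatGBD)

/-- The path space `X_B`: infinite sequences of composable edges. -/
def Path := { x : (n : ℕ) → B.E n // ∀ n, B.src (n + 1) (x (n + 1)) = B.rng n (x n) }

/-- An order on a Bratteli diagram: a partial order on each edge set such that two edges
are comparable iff they have the same range, and which is linear on each set `r⁻¹(v)`. -/
structure EdgeOrder where
  le : (n : ℕ) → B.E n → B.E n → Prop
  le_rng : ∀ n e f, le n e f → B.rng n e = B.rng n f
  le_refl : ∀ n e, le n e e
  le_antisymm : ∀ n e f, le n e f → le n f e → e = f
  le_trans : ∀ n e f g, le n e f → le n f g → le n e g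
  le_total : ∀ n e f, B.rng n e = B.rng n f → le n e f ∨ le n f e

/-- An edge is maximal if it is the largest element of `r⁻¹(r(e))`. -/
def IsMaxEdge (ω : B.EdgeOrder) (n : ℕ) (e : B.E n) : Prop :=
  ∀ f : B.E n, B.rng n f = B.rng n e → ω.le n f e

/-- An edge is minimal if it is the smallest element of `r⁻¹(r(e))`. -/
def IsMinEdge (ω : B.EdgeOrder) (n : ℕ) (e : B.E n) : Prop :=
  ∀ f : B.E n, B.rng n f = B.rng n e → ω.le n e f

/-- An infinite path is maximal if all of its edges are maximal. -/
def IsMaxPath (ω : B.EdgeOrder) (x : B.Path) : Prop := ∀ n, B.IsMaxEdge ω n (x.1 n)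

/-- An infinite path is minimal if all of its edges are minimal. -/
def IsMinPath (ω : B.EdgeOrder) (x : B.Path) : Prop := ∀ n, B.IsMinEdge ω n (x.1 n)

end NatGBD

theorem key_exists (B : NatGBD) (n : ℕ) (P : Prop)
    (h : P → ∀ v : ℕ, ∃ e f : B.E n, e ≠ f ∧
      B.rng n e = v ∧ B.rng n f = v ∧ B.rng n e < B.src n e ∧ B.rng n f < B.src n f) :
    ∃ key : B.E n → ℕ ×ₗ ℕ, Function.Injective key ∧ (P → ∀ x : B.E n,
      ((∀ f, B.rng n f = B.rng n x → key f ≤ key x) → B.rng n x < B.src n x) ∧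
      ((∀ f, B.rng n f = B.rng n x → key x ≤ key f) → B.rng n x < B.src n x)) := by
  classical
  haveI := B.countE n
  obtain ⟨c, hc⟩ := exists_injective_nat (B.E n)
  by_cases hP : P
  · choose a b hab ha hb hsa hsb using h hP
    let k : B.E n → ℕ := fun e =>
      if e = a (B.rng n e) then 0 else if e = b (B.rng n e) then 2 else 1
    refine ⟨fun e => toLex (k e, c e), ?_, fun _ x => ⟨fun hx => ?_, fun hx => ?_⟩⟩
    · intro e f hef
      have h2 := congrArg (fun p => (ofLex p).2) hef
      exact hc h2
    · have h1 := hx (b (B.rng n x)) (hb _)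
      have h2 : k (b (B.rng n x)) = 2 := by
        simp only [k, hb]
        rw [if_neg (hab _).symm]
        simp
      have h3 : 2 ≤ k x := by
        rw [Prod.Lex.toLex_le_toLex] at h1
        simp only [h2] at h1
        omega
      have h4 : x = b (B.rng n x) := by
        by_contra hne
        simp only [k, if_neg hne] at h3
        split_ifs at h3 <;> omega
      have h5 := hsb (B.rng n x)
      rwa [← h4] at h5
    · have h1 := hx (a (B.rng n x)) (ha _)
      have h2 : k (a (B.rng n x)) = 0 := by
        simp only [k, ha]
        simp
      have h3 : k x ≤ 0 := by
        rw [Prod.Lex.toLex_le_toLex] at h1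
        simp only [h2] at h1
        omega
      have h4 : x = a (B.rng n x) := by
        by_contra hne
        simp only [k, if_neg hne] at h3
        split_ifs at h3 <;> omega
      have h5 := hsa (B.rng n x)
      rwa [← h4] at h5
  · refine ⟨fun e => toLex (0, c e), ?_, fun h => absurd h hP⟩
    intro e f hef
    have h2 := congrArg (fun p => (ofLex p).2) hef
    exact hc h2

theorem no_slanted_path (B : NatGBD) (x : B.Path) (N : ℕ)
    (h : ∀ n, N ≤ n → B.rng n (x.1 n) < B.src n (x.1 n)) : False := by
  have key : ∀ m, B.src (N + m) (x.1 (N + m)) + m ≤ B.src N (x.1 N) := by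
    intro m
    induction m with
    | zero => simp
    | succ m ih =>
      have h1 := h (N + m) (by omega)
      have h2 := x.2 (N + m)
      have h3 : B.src (N + (m + 1)) (x.1 (N + (m + 1))) = B.rng (N + m) (x.1 (N + m)) := h2
      omega
  have := key (B.src N (x.1 N) + 1)
  omega

/-- Let `B` be a generalized Bratteli diagram with vertex levels
identified with `ℕ`. If there is a level `N` such that from that level on, every vertex
has at least two incoming edges slanted from right to left (i.e. with `r(e) < s(e)`),
then `B` admits an order for which the sets of infinite maximal paths and of infinite
minimal paths are both empty. -/
theorem exists_order_no_max_no_min (B : NatGBD)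
    (h : ∃ N : ℕ, ∀ n : ℕ, N ≤ n → ∀ v : ℕ, ∃ e f : B.E n, e ≠ f ∧
      B.rng n e = v ∧ B.rng n f = v ∧ B.rng n e < B.src n e ∧ B.rng n f < B.src n f) :
    ∃ ω : B.EdgeOrder, (∀ x : B.Path, ¬ B.IsMaxPath ω x) ∧
      (∀ x : B.Path, ¬ B.IsMinPath ω x) := by
  obtain ⟨N, hN⟩ := h
  choose key hinj hkey using fun n => key_exists B n (N ≤ n) (hN n)
  refine ⟨⟨fun n e f => B.rng n e = B.rng n f ∧ key n e ≤ key n f, fun n e f h => h.1,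
    fun n e => ⟨rfl, le_rfl⟩, fun n e f h1 h2 => hinj n (le_antisymm h1.2 h2.2),
    fun n e f g h1 h2 => ⟨h1.1.trans h2.1, h1.2.trans h2.2⟩,
    fun n e f h => (le_total (key n e) (key n f)).imp (fun h' => ⟨h, h'⟩)
      (fun h' => ⟨h.symm, h'⟩)⟩, fun x hx => ?_, fun x hx => ?_⟩
  · exact no_slanted_path B x N fun n hn =>
      (hkey n hn (x.1 n)).1 fun f hf => (hx n f hf).2
  · exact no_slanted_path B x N fun n hn =>
      (hkey n hn (x.1 n)).2 fun f hf => (hx n f hf).2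
end

section
/- Let B=(V,E) be a generalized Bratteli diagram of bounded size with data (t_n,L_n)_{n≥0}. For w∈V_0 define the slanting sets Z_w^+ = {x=(x_n)∈X_B : s(x_0)≥w and r(x_n) ≥ w+∑_{i=0}^{n} t_i for all n≥0} and Z_w^- = {x=(x_n)∈X_B : s(x_0)≤w and r(x_n) ≤ w−∑_{i=0}^{n} t_i for all n≥0}. Then for every w∈V_0 the sets Z_w^+ and Z_w^- are invariant with respect to the tail equivalence relation: if x∈Z_w^+ (resp. Z_w^-) and y is tail equivalent to x, then y∈Z_w^+ (resp. Z_w^-). -/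
open Set

/-- For a bounded size generalized Bratteli diagram, the slanting sets
`Z_w^+` and `Z_w^-` are invariant with respect to the tail equivalence relation. -/
theorem slanting_sets_tail_invariant (B : BddGBD) (w : ℤ) :
    (∀ x ∈ B.Zplus w, ∀ y : B.Path, B.TailEquiv x y → y ∈ B.Zplus w) ∧
    (∀ x ∈ B.Zminus w, ∀ y : B.Path, B.TailEquiv x y → y ∈ B.Zminus w) := by
  constructor
  · rintro x ⟨_, hx⟩ y ⟨N, hN⟩
    have key : ∀ k n : ℕ, N ≤ n + k →
        w + ∑ i ∈ Finset.range (n + 1), (B.t i : ℤ) ≤ B.rng n (y.1 n) := by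
      intro k
      induction k with
      | zero => intro n hn; rw [← hN n (by omega)]; exact hx n
      | succ k ih =>
        intro n hn
        have h1 := ih (n + 1) (by omega)
        rw [Finset.sum_range_succ] at h1
        have h2 := (B.src_mem (n + 1) (y.1 (n + 1))).1
        rw [y.2 n] at h2
        linarith
    refine ⟨?_, fun n => key N n (by omega)⟩
    have h1 := key N 0 (by omega)
    have h2 := (B.src_mem 0 (y.1 0)).1
    simp only [zero_add, Finset.sum_range_one] at h1
    linarith
  · rintro x ⟨_, hx⟩ y ⟨N, hN⟩
    have key : ∀ k n : ℕ, N ≤ n + k →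
        B.rng n (y.1 n) ≤ w - ∑ i ∈ Finset.range (n + 1), (B.t i : ℤ) := by
      intro k
      induction k with
      | zero => intro n hn; rw [← hN n (by omega)]; exact hx n
      | succ k ih =>
        intro n hn
        have h1 := ih (n + 1) (by omega)
        rw [Finset.sum_range_succ] at h1
        have h2 := (B.src_mem (n + 1) (y.1 (n + 1))).2
        rw [y.2 n] at h2
        linarith
    refine ⟨?_, fun n => key N n (by omega)⟩
    have h1 := key N 0 (by omega)
    have h2 := (B.src_mem 0 (y.1 0)).2
    simp only [zero_add, Finset.sum_range_one] at h1
    linarith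
end

section
/- Let B=(V,E) be a generalized Bratteli diagram of bounded size with data (t_n,L_n)_{n≥0}. For w∈V_0 let Y_w^+ be the set of infinite paths x with s(x_0)=w and r(x_m)=w+∑_{i=0}^{m} t_i for every m≥0 (the paths through the rightmost possible vertex on each level), and let Y_w^- be defined symmetrically through the leftmost possible vertices. If Y_w^+ is finite for all w∈V_0, then Z_w^+ is countable for all w∈V_0; if Y_w^+ is infinite for some w∈V_0, then Z_w^+ is uncountable for that w. The same statements hold for Y_w^- and Z_w^-. In particular, if |E(v+t_n,v)| = |E(v−t_n,v)| = 1 for all v∈V_{n+1} and all n, then Z_w^+ and Z_w^- are countable for all w∈V_0. -/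
open Set

theorem pi_finite_of_countable {A : ℕ → Type} [∀ n, Nonempty (A n)] [∀ n, Finite (A n)]
    [Countable (∀ n, A n)] : Finite (∀ n, A n) := by
  classical
  by_cases h : ∃ N, ∀ n, N ≤ n → Subsingleton (A n)
  · obtain ⟨N, hN⟩ := h
    refine Finite.of_injective (β := ∀ i : Fin N, A i) (fun f i => f i) ?_
    intro f g hfg
    funext n
    by_cases hn : n < N
    · exact congrFun hfg ⟨n, hn⟩
    · exact (hN n (not_lt.mp hn)).elim _ _
  · exfalso
    push Not at h
    obtain ⟨φ, hφ, hP⟩ := Nat.exists_strictMono_subsequence (P := fun n => Nontrivial (A n))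
      (fun N => by
        obtain ⟨n, hn, h2⟩ := h (N + 1)
        exact ⟨n, hn, h2⟩)
    obtain ⟨f, hf⟩ := exists_surjective_nat (∀ n, A n)
    have key : ∀ n, ∃ a : A n, ∀ k, φ k = n → a ≠ f k n := by
      intro n
      by_cases hk : ∃ k, φ k = n
      · obtain ⟨k, rfl⟩ := hk
        have := hP k
        obtain ⟨a, ha⟩ := exists_ne (f k (φ k))
        refine ⟨a, fun k' hk' => ?_⟩
        rw [hφ.injective hk']
        exact ha
      · exact ⟨Classical.arbitrary _, fun k hk' => absurd ⟨k, hk'⟩ hk⟩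
    choose g hg using key
    obtain ⟨k, hk⟩ := hf g
    exact hg (φ k) k rfl (by rw [hk])

namespace BddGBD

theorem path_ext (B : BddGBD) {x y : B.Path} (h : ∀ n, x.1 n = y.1 n) : x = y :=
  Subtype.ext (funext h)

/-- slanted edges along the boundary ray -/
abbrev Ray (B : BddGBD) (w : ℤ) (n : ℕ) : Type :=
  {e : B.E n // B.rng n e = w + ∑ i ∈ Finset.range (n + 1), (B.t i : ℤ) ∧
    B.src n e = w + ∑ i ∈ Finset.range n, (B.t i : ℤ)}

theorem ray_nonempty (B : BddGBD) (w : ℤ) (n : ℕ) : Nonempty (B.Ray w n) := by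
  obtain ⟨e, h1, h2⟩ := B.exists_leftmost n (w + ∑ i ∈ Finset.range (n + 1), (B.t i : ℤ))
  refine ⟨e, h1, ?_⟩
  rw [h2, Finset.sum_range_succ]
  ring

theorem ray_finite (B : BddGBD) (w : ℤ) (n : ℕ) : Finite (B.Ray w n) :=
  ((B.rng_fin n (w + ∑ i ∈ Finset.range (n + 1), (B.t i : ℤ))).subset
    (fun _ he => he.1)).to_subtype

theorem src_of_Yplus (B : BddGBD) {w : ℤ} {x : B.Path} (hx : x ∈ B.Yplus w) (n : ℕ) :
    B.src n (x.1 n) = w + ∑ i ∈ Finset.range n, (B.t i : ℤ) := by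
  cases n with
  | zero => simpa using hx.1
  | succ n => rw [x.2 n]; exact hx.2 n

/-- paths from products of slanted edges -/
def ofRay (B : BddGBD) (w : ℤ) (f : ∀ n, B.Ray w n) : B.Yplus w :=
  ⟨⟨fun n => (f n).1, fun n => by rw [(f (n + 1)).2.2, (f n).2.1]⟩,
    by simpa using (f 0).2.2, fun n => (f n).2.1⟩

theorem ofRay_injective (B : BddGBD) (w : ℤ) : Function.Injective (B.ofRay w) := by
  intro f g h
  funext n
  apply Subtype.ext
  exact congrArg (fun y : B.Yplus w => y.1.1 n) h

theorem ofRay_surjective (B : BddGBD) (w : ℤ) : Function.Surjective (B.ofRay w) := by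
  intro y
  exact ⟨fun n => ⟨y.1.1 n, y.2.2 n, B.src_of_Yplus y.2 n⟩, rfl⟩

theorem Yplus_finite_of_countable (B : BddGBD) (w : ℤ) (h : (B.Yplus w).Countable) :
    (B.Yplus w).Finite := by
  have := B.ray_nonempty w
  have := B.ray_finite w
  have : Countable (B.Yplus w) := h.to_subtype
  have : Countable (∀ n, B.Ray w n) := (B.ofRay_injective w).countable
  have : Finite (∀ n, B.Ray w n) := pi_finite_of_countable
  have : Finite (B.Yplus w) := Finite.of_surjective _ (B.ofRay_surjective w)
  exact Set.toFinite _

theorem Yplus_subset_Zplus (B : BddGBD) (w : ℤ) : B.Yplus w ⊆ B.Zplus w :=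
  fun _ hx => ⟨hx.1.ge, fun n => (hx.2 n).ge⟩

theorem countable_tail (B : BddGBD) (y : B.Path) : {x | B.TailEquiv x y}.Countable := by
  have := B.countE
  have : {x | B.TailEquiv x y} ⊆ ⋃ N, {x : B.Path | ∀ n, N ≤ n → x.1 n = y.1 n} := by
    rintro x ⟨N, hN⟩
    exact Set.mem_iUnion.2 ⟨N, hN⟩
  refine (Set.countable_iUnion fun N => ?_).mono this
  have hinj : Function.Injective
      (fun (x : {x : B.Path | ∀ n, N ≤ n → x.1 n = y.1 n}) (i : Fin N) => x.1.1 i) := by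
    intro a b hab
    apply Subtype.ext
    apply B.path_ext
    intro n
    by_cases hn : n < N
    · exact congrFun hab ⟨n, hn⟩
    · rw [a.2 n (not_lt.mp hn), b.2 n (not_lt.mp hn)]
  exact hinj.countable

theorem Zplus_tail (B : BddGBD) (w : ℤ) (x : B.Path) (hx : x ∈ B.Zplus w) :
    ∃ w' : ℤ, ∃ y ∈ B.Yplus w', B.TailEquiv x y := by
  classical
  set d : ℕ → ℤ := fun n => B.rng n (x.1 n) - (w + ∑ i ∈ Finset.range (n + 1), (B.t i : ℤ)) with hd
  have h0 : ∀ n, 0 ≤ d n := fun n => sub_nonneg.2 (hx.2 n)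
  have hanti : ∀ n, d (n + 1) ≤ d n := by
    intro n
    have h1 := (B.src_mem (n + 1) (x.1 (n + 1))).1
    have h2 := x.2 n
    simp only [hd]
    rw [Finset.sum_range_succ _ (n + 1)]
    linarith
  have hA : Antitone d := antitone_nat_of_succ_le hanti
  obtain ⟨N, hN⟩ : ∃ N, ∀ n, (d N).toNat ≤ (d n).toNat :=
    ⟨_, fun n => Function.argmin_le (fun n => (d n).toNat) n⟩
  have hc : ∀ n, N ≤ n → d n = d N := by
    intro n hn
    have := hA hn
    have := hN n
    have := h0 n
    have := h0 N
    omega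
  set w' := w + d N with hw'
  have hr : ∀ n, N ≤ n →
      B.rng n (x.1 n) = w' + ∑ i ∈ Finset.range (n + 1), (B.t i : ℤ) := by
    intro n hn
    have := hc n hn
    have h2 : d n = B.rng n (x.1 n) - (w + ∑ i ∈ Finset.range (n + 1), (B.t i : ℤ)) := rfl
    linarith
  have hs : ∀ n, N + 1 ≤ n →
      B.src n (x.1 n) = w' + ∑ i ∈ Finset.range n, (B.t i : ℤ) := by
    intro n hn
    obtain ⟨m, rfl⟩ : ∃ m, n = m + 1 := ⟨n - 1, by omega⟩
    rw [x.2 m]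
    exact hr m (by omega)
  refine ⟨w', _, (B.ofRay w' fun n => if hn : N + 1 ≤ n then
    ⟨x.1 n, hr n (by omega), hs n hn⟩ else (B.ray_nonempty w' n).some).2, N + 1, ?_⟩
  intro n hn
  have hn' : N < n := hn
  simp [ofRay, hn']

theorem Zplus_countable (B : BddGBD) (h : ∀ w, (B.Yplus w).Finite) (w : ℤ) :
    (B.Zplus w).Countable := by
  have hsub : B.Zplus w ⊆ ⋃ w' : ℤ, ⋃ y ∈ B.Yplus w', {x | B.TailEquiv x y} := by
    intro x hx
    obtain ⟨w', y, hy, hxy⟩ := B.Zplus_tail w x hx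
    simp only [Set.mem_iUnion]
    exact ⟨w', y, hy, hxy⟩
  refine (Set.countable_iUnion fun w' => ?_).mono hsub
  exact (h w').countable.biUnion fun y _ => B.countable_tail y

theorem Yplus_finite_of_card (B : BddGBD)
    (h : ∀ (n : ℕ) (v : ℤ),
      Nat.card {e : B.E n // B.rng n e = v ∧ B.src n e = v - B.t n} = 1) (w : ℤ) :
    (B.Yplus w).Finite := by
  apply Set.Subsingleton.finite
  intro x hx y hy
  apply B.path_ext
  intro n
  have := (Nat.card_eq_one_iff_unique.1
    (h n (w + ∑ i ∈ Finset.range (n + 1), (B.t i : ℤ)))).1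
  have key : ∀ z : B.Path, z ∈ B.Yplus w → B.src n (z.1 n) =
      w + ∑ i ∈ Finset.range (n + 1), (B.t i : ℤ) - B.t n := by
    intro z hz
    rw [B.src_of_Yplus hz n, Finset.sum_range_succ]
    ring
  exact congrArg Subtype.val (this.elim ⟨x.1 n, hx.2 n, key x hx⟩ ⟨y.1 n, hy.2 n, key y hy⟩)

/-- the mirror image of a diagram -/
def mirror (B : BddGBD) : BddGBD where
  E := B.E
  countE := B.countE
  src n e := - B.src n e
  rng n e := - B.rng n e
  src_surj n v := by
    obtain ⟨e, he⟩ := B.src_surj n (-v)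
    exact ⟨e, by rw [he, neg_neg]⟩
  rng_surj n v := by
    obtain ⟨e, he⟩ := B.rng_surj n (-v)
    exact ⟨e, by rw [he, neg_neg]⟩
  rng_fin n v := by
    simp only [neg_eq_iff_eq_neg]
    exact B.rng_fin n (-v)
  t := B.t
  L := B.L
  src_mem n e := by
    have := B.src_mem n e
    constructor <;> linarith [this.1, this.2]
  card_le n v := by
    simp only [neg_eq_iff_eq_neg]
    exact B.card_le n (-v)
  exists_rightmost n v := by
    obtain ⟨e, h1, h2⟩ := B.exists_leftmost n (-v)
    exact ⟨e, by linarith, by linarith⟩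
  exists_leftmost n v := by
    obtain ⟨e, h1, h2⟩ := B.exists_rightmost n (-v)
    exact ⟨e, by linarith, by linarith⟩

/-- the mirror map on paths -/
def mir (B : BddGBD) : B.Path ≃ B.mirror.Path where
  toFun x := ⟨x.1, fun n => congrArg Neg.neg (x.2 n)⟩
  invFun x := ⟨x.1, fun n => neg_injective (x.2 n)⟩
  left_inv _ := rfl
  right_inv _ := rfl

theorem mir_Y (B : BddGBD) (w : ℤ) : B.Yminus w = B.mir ⁻¹' (B.mirror.Yplus (-w)) := by
  ext x
  change (_ ∧ _) ↔ (- B.src 0 (x.1 0) = -w ∧ ∀ m : ℕ, - B.rng m (x.1 m) =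
    -w + ∑ i ∈ Finset.range (m + 1), (B.t i : ℤ))
  refine and_congr ⟨fun h => by linarith, fun h => by linarith⟩
    (forall_congr' fun n => ⟨fun h => by linarith, fun h => by linarith⟩)

theorem mir_Z (B : BddGBD) (w : ℤ) : B.Zminus w = B.mir ⁻¹' (B.mirror.Zplus (-w)) := by
  ext x
  change (_ ∧ _) ↔ (-w ≤ - B.src 0 (x.1 0) ∧ ∀ m : ℕ,
    -w + ∑ i ∈ Finset.range (m + 1), (B.t i : ℤ) ≤ - B.rng m (x.1 m))
  refine and_congr ⟨fun h => by linarith, fun h => by linarith⟩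
    (forall_congr' fun n => ⟨fun h => by linarith, fun h => by linarith⟩)

theorem mir_Y_finite (B : BddGBD) (w : ℤ) :
    (B.Yminus w).Finite ↔ (B.mirror.Yplus (-w)).Finite := by
  rw [mir_Y]
  refine ⟨fun h => ?_, fun h => h.preimage B.mir.injective.injOn⟩
  have := h.image B.mir
  rwa [Set.image_preimage_eq _ B.mir.surjective] at this

theorem mir_Z_countable (B : BddGBD) (w : ℤ) :
    (B.Zminus w).Countable ↔ (B.mirror.Zplus (-w)).Countable := by
  rw [mir_Z]
  refine ⟨fun h => ?_, fun h => h.preimage_of_injOn B.mir.injective.injOn⟩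
  have := h.image B.mir
  rwa [Set.image_preimage_eq _ B.mir.surjective] at this

theorem Zplus_uncountable (B : BddGBD) (w : ℤ) (h : ¬ (B.Yplus w).Finite) :
    ¬ (B.Zplus w).Countable :=
  fun hc => h (B.Yplus_finite_of_countable w (hc.mono (B.Yplus_subset_Zplus w)))

theorem Zminus_countable (B : BddGBD) (h : ∀ w, (B.Yminus w).Finite) (w : ℤ) :
    (B.Zminus w).Countable := by
  rw [mir_Z_countable]
  refine B.mirror.Zplus_countable (fun v => ?_) _
  have := (B.mir_Y_finite (-v)).1 (h (-v))
  rwa [neg_neg] at this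

end BddGBD

/-- For a bounded size generalized Bratteli diagram: if the boundary
sets `Y_w^+` are finite for all `w ∈ V_0`, then the slanting sets `Z_w^+` are countable
for all `w`; if `Y_w^+` is infinite for some `w`, then `Z_w^+` is uncountable for that
`w`; and likewise for `Y_w^-`, `Z_w^-`. In particular, if `|E(v + t_n, v)| =
|E(v - t_n, v)| = 1` for all `v ∈ V_{n+1}` and all `n`, then `Z_w^+` and `Z_w^-` are
countable for all `w ∈ V_0`. -/
theorem slanting_sets_cardinality (B : BddGBD) :
    ((∀ w : ℤ, (B.Yplus w).Finite) → ∀ w : ℤ, (B.Zplus w).Countable) ∧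
    (∀ w : ℤ, ¬ (B.Yplus w).Finite → ¬ (B.Zplus w).Countable) ∧
    ((∀ w : ℤ, (B.Yminus w).Finite) → ∀ w : ℤ, (B.Zminus w).Countable) ∧
    (∀ w : ℤ, ¬ (B.Yminus w).Finite → ¬ (B.Zminus w).Countable) ∧
    ((∀ (n : ℕ) (v : ℤ),
        Nat.card {e : B.E n // B.rng n e = v ∧ B.src n e = v + B.t n} = 1 ∧
        Nat.card {e : B.E n // B.rng n e = v ∧ B.src n e = v - B.t n} = 1) →
      ∀ w : ℤ, (B.Zplus w).Countable ∧ (B.Zminus w).Countable) := by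
  refine ⟨B.Zplus_countable, B.Zplus_uncountable, B.Zminus_countable, ?_, ?_⟩
  · intro w h
    rw [B.mir_Z_countable]
    rw [B.mir_Y_finite] at h
    exact B.mirror.Zplus_uncountable _ h
  · intro h w
    refine ⟨B.Zplus_countable (B.Yplus_finite_of_card fun n v => (h n v).2) w,
      B.Zminus_countable (fun v => ?_) w⟩
    rw [B.mir_Y_finite]
    refine B.mirror.Yplus_finite_of_card (fun n v => ?_) _
    rw [← (h n (-v)).1]
    refine Nat.card_congr (Equiv.subtypeEquivRight fun e => ?_)
    change (- B.rng n e = v ∧ - B.src n e = v - B.t n) ↔ _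
    constructor <;> rintro ⟨h1, h2⟩ <;> constructor <;> linarith
end

section
/- Let B(F) be the one-sided stationary generalized Bratteli diagram whose vertex levels are identified with ℕ = {1,2,3,…} and whose incidence matrix F = (f_{vw}) is given by f_{kk} = k+1 and f_{k,k+1} = 1 for all k∈ℕ, and f_{vw} = 0 otherwise. Then every tail-invariant Borel measure on the path space X_B that assigns a finite value to every cylinder set is the zero measure; i.e., there does not exist a nonzero tail-invariant measure on X_B taking finite values on cylinder sets. -/
open MeasureTheory

/-- The vertex set `ℕ = {1, 2, 3, …}` of each level of the diagram. -/
abbrev BD11.Vtx : Type := {k : ℕ // 1 ≤ k}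

/-- The incidence matrix: `F v w` is the number of edges from the vertex `w` of one
level to the vertex `v` of the next level; `f_{kk} = k + 1`, `f_{k, k+1} = 1`, and all
other entries vanish. -/
def BD11.F : BD11.Vtx → BD11.Vtx → ℕ :=
  fun v w => if (w : ℕ) = (v : ℕ) then (v : ℕ) + 1
    else if (w : ℕ) = (v : ℕ) + 1 then 1 else 0

/-- The edges of the stationary diagram `B(F)`: an edge is a triple
`(source, range, index)` with `index < F range source`. -/
abbrev BD11.Edge : Type :=
  {p : BD11.Vtx × BD11.Vtx × ℕ // p.2.2 < BD11.F p.2.1 p.1}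

/-- The source of an edge. -/
def BD11.src (e : BD11.Edge) : BD11.Vtx := e.1.1

/-- The range of an edge. -/
def BD11.rng (e : BD11.Edge) : BD11.Vtx := e.1.2.1

/-- The path space `X_B` of the stationary diagram `B(F)`, with its cylinder-set
(product) σ-algebra, which is the Borel σ-algebra of the cylinder-set topology. -/
abbrev BD11.Path : Type :=
  {x : ℕ → BD11.Edge // ∀ n, BD11.src (x (n + 1)) = BD11.rng (x n)}

/-- Finite paths of `n + 1` composable edges, from level `0` to level `n + 1`. -/
abbrev BD11.FinPath (n : ℕ) : Type :=
  {p : Fin (n + 1) → BD11.Edge // ∀ i : Fin n, BD11.src (p i.succ) = BD11.rng (p i.castSucc)}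

/-- The range of a finite path: a vertex of level `n + 1`. -/
def BD11.out {n : ℕ} (p : BD11.FinPath n) : BD11.Vtx := BD11.rng (p.1 (Fin.last n))

/-- The cylinder set of a finite path. -/
def BD11.cyl {n : ℕ} (p : BD11.FinPath n) : Set BD11.Path :=
  {x : BD11.Path | ∀ i : Fin (n + 1), x.1 i.1 = p.1 i}

def BD11.loop (k : BD11.Vtx) (i : Fin (k.1 + 1)) : BD11.Edge :=
  ⟨(k, k, i.1), by simp [BD11.F]; omega⟩

def BD11.up (k : BD11.Vtx) : BD11.Vtx := ⟨k.1 + 1, by omega⟩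

def BD11.down (k : BD11.Vtx) : BD11.Edge :=
  ⟨(BD11.up k, k, 0), by simp [BD11.F, BD11.up]⟩

def BD11.constP (n : ℕ) (k : BD11.Vtx) : BD11.FinPath n :=
  ⟨fun _ => BD11.loop k 0, fun _ => rfl⟩

lemma BD11.out_constP (n : ℕ) (k : BD11.Vtx) : BD11.out (BD11.constP n k) = k := rfl

def BD11.snoc {n : ℕ} (p : BD11.FinPath n) (e : BD11.Edge) (h : BD11.src e = BD11.out p) :
    BD11.FinPath (n + 1) :=
  ⟨fun i => if hi : i.1 < n + 1 then p.1 ⟨i.1, hi⟩ else e, by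
    intro i
    by_cases hi : i.1 + 1 < n + 1
    · have h2 : i.1 < n + 1 := by omega
      have := p.2 ⟨i.1, by omega⟩
      simpa [hi, h2] using this
    · have h2 : i.1 = n := by omega
      simp only [Fin.val_succ, Fin.val_castSucc, h2]
      simpa [BD11.out, Fin.last] using h⟩

lemma BD11.out_snoc {n : ℕ} (p : BD11.FinPath n) (e : BD11.Edge) (h : BD11.src e = BD11.out p) :
    BD11.out (BD11.snoc p e h) = BD11.rng e := by
  simp [BD11.out, BD11.snoc]

lemma BD11.mem_cyl_snoc {n : ℕ} (p : BD11.FinPath n) (e : BD11.Edge)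
    (h : BD11.src e = BD11.out p) (x : BD11.Path) :
    x ∈ BD11.cyl (BD11.snoc p e h) ↔ x ∈ BD11.cyl p ∧ x.1 (n + 1) = e := by
  simp only [BD11.cyl, Set.mem_ofPred_eq, BD11.snoc]
  constructor
  · intro hx
    refine ⟨fun i => ?_, ?_⟩
    · have := hx i.castSucc
      have h2 : i.1 < n + 1 := i.2
      simp only [Fin.val_castSucc, h2, dif_pos] at this
      exact this
    · have := hx (Fin.last (n + 1))
      simpa using this
  · rintro ⟨h1, h2⟩ i
    by_cases hi : i.1 < n + 1
    · simpa [hi] using h1 ⟨i.1, hi⟩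
    · have h3 : i.1 = n + 1 := by omega
      simp [h3, h2]

lemma BD11.meas_cyl {n : ℕ} (p : BD11.FinPath n) : MeasurableSet (BD11.cyl p) := by
  have : BD11.cyl p = ⋂ i : Fin (n + 1), (fun x : BD11.Path => x.1 i.1) ⁻¹' {p.1 i} := by
    ext x; simp [BD11.cyl]
  rw [this]
  refine MeasurableSet.iInter fun i => ?_
  have hm : Measurable (fun x : BD11.Path => x.1 i.1) :=
    (measurable_pi_apply _).comp measurable_subtype_coe
  exact hm (MeasurableSet.singleton _)

def BD11.trunc (x : BD11.Path) (n : ℕ) : BD11.FinPath n :=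
  ⟨fun i => x.1 i.1, fun i => x.2 i.1⟩

lemma BD11.src_of_mem {n : ℕ} (p : BD11.FinPath n) (x : BD11.Path) (hx : x ∈ BD11.cyl p) :
    BD11.src (x.1 (n + 1)) = BD11.out p := by
  rw [x.2 n, BD11.out, ← hx (Fin.last n)]; rfl

lemma BD11.edge_cases (k : BD11.Vtx) (e : BD11.Edge) (h : BD11.src e = k) :
    (∃ i, e = BD11.loop k i) ∨ (BD11.rng e).1 < k.1 := by
  obtain ⟨⟨w, v, j⟩, he⟩ := e
  simp only [BD11.src] at h
  subst h
  simp only [BD11.F] at he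
  split_ifs at he with h1 h2
  · left
    have : w = v := Subtype.ext h1
    subst this
    exact ⟨⟨j, he⟩, rfl⟩
  · right
    simp only [BD11.rng]; omega
  · omega

section
variable (μ : Measure BD11.Path)

lemma BD11.upper
    (hinv : ∀ (n : ℕ) (p q : BD11.FinPath n), BD11.out p = BD11.out q →
      μ (BD11.cyl p) = μ (BD11.cyl q)) (k : BD11.Vtx)
    (hnull : ∀ (n : ℕ) (p : BD11.FinPath n), (BD11.out p).1 < k.1 → μ (BD11.cyl p) = 0) (n : ℕ) :
    μ (BD11.cyl (BD11.constP n k)) ≤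
      ((k.1 + 1 : ℕ) : ENNReal) * μ (BD11.cyl (BD11.constP (n + 1) k)) := by
  set p := BD11.constP n k
  have hsub : BD11.cyl p ⊆ (⋃ i : Fin (k.1 + 1), BD11.cyl (BD11.snoc p (BD11.loop k i) rfl)) ∪
      ⋃ q : {q : BD11.FinPath (n + 1) // (BD11.out q).1 < k.1}, BD11.cyl q.1 := by
    intro x hx
    rcases BD11.edge_cases k (x.1 (n + 1)) (BD11.src_of_mem p x hx) with ⟨i, hi⟩ | h
    · left
      exact Set.mem_iUnion.2 ⟨i, (BD11.mem_cyl_snoc _ _ _ _).2 ⟨hx, hi⟩⟩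
    · right
      exact Set.mem_iUnion.2 ⟨⟨BD11.trunc x (n + 1), h⟩, fun i => rfl⟩
  have h0 : μ (⋃ q : {q : BD11.FinPath (n + 1) // (BD11.out q).1 < k.1}, BD11.cyl q.1) = 0 :=
    measure_iUnion_null fun q => hnull _ q.1 q.2
  calc μ (BD11.cyl p) ≤ _ := measure_mono hsub
    _ ≤ _ := measure_union_le _ _
    _ = μ (⋃ i : Fin (k.1 + 1), BD11.cyl (BD11.snoc p (BD11.loop k i) rfl)) := by
      rw [h0, add_zero]
    _ ≤ ∑ i : Fin (k.1 + 1), μ (BD11.cyl (BD11.snoc p (BD11.loop k i) rfl)) :=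
      measure_iUnion_fintype_le _ _
    _ = ∑ i : Fin (k.1 + 1), μ (BD11.cyl (BD11.constP (n + 1) k)) := by
      refine Finset.sum_congr rfl fun i _ => hinv _ _ _ ?_
      exact BD11.out_snoc _ _ _
    _ = _ := by simp

lemma BD11.lower
    (hinv : ∀ (n : ℕ) (p q : BD11.FinPath n), BD11.out p = BD11.out q →
      μ (BD11.cyl p) = μ (BD11.cyl q)) (k : BD11.Vtx) (n : ℕ) :
    μ (BD11.cyl (BD11.constP (n + 1) k)) +
      ((k.1 + 2 : ℕ) : ENNReal) * μ (BD11.cyl (BD11.constP (n + 1) (BD11.up k)))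
      ≤ μ (BD11.cyl (BD11.constP n (BD11.up k))) := by
  set p := BD11.constP n (BD11.up k)
  let E : Option (Fin ((BD11.up k).1 + 1)) → BD11.Edge :=
    fun o => o.elim (BD11.down k) (BD11.loop (BD11.up k))
  have hE : ∀ o, BD11.src (E o) = BD11.out p := by
    rintro (_ | i) <;> rfl
  have hinj : Function.Injective E := by
    rintro (_ | i) (_ | j) h
    · rfl
    · have := congrArg (fun e => (BD11.rng e).1) h
      change k.1 = k.1 + 1 at this
      omega
    · have := congrArg (fun e => (BD11.rng e).1) h
      change k.1 + 1 = k.1 at this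
      omega
    · have := congrArg (fun e => e.1.2.2) h
      simp only [E, BD11.loop, Option.elim] at this
      rw [Fin.ext this]
  have hd : Pairwise (Function.onFun Disjoint fun o => BD11.cyl (BD11.snoc p (E o) (hE o))) := by
    intro a b hab
    refine Set.disjoint_left.2 fun x hx hy => hab (hinj ?_)
    rw [BD11.mem_cyl_snoc] at hx hy
    rw [← hx.2, hy.2]
  have hU := measure_iUnion (μ := μ) hd fun o => BD11.meas_cyl _
  rw [tsum_fintype, Fintype.sum_option] at hU
  have h1 : μ (BD11.cyl (BD11.snoc p (E none) (hE none))) =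
      μ (BD11.cyl (BD11.constP (n + 1) k)) := by
    apply hinv; rw [BD11.out_snoc]; rfl
  have h2 : ∀ i, μ (BD11.cyl (BD11.snoc p (E (some i)) (hE (some i)))) =
      μ (BD11.cyl (BD11.constP (n + 1) (BD11.up k))) := by
    intro i
    apply hinv; rw [BD11.out_snoc]; rfl
  simp only [h1, h2, Finset.sum_const, Finset.card_univ, Fintype.card_fin, nsmul_eq_mul] at hU
  refine hU.symm.le.trans ?_
  refine measure_mono (Set.iUnion_subset fun o x hx => ?_)
  exact ((BD11.mem_cyl_snoc _ _ _ _).1 hx).1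

end

lemma BD11.arith (K : ℕ) (a b : ℕ → ENNReal) (ha : ∀ n, a n ≤ ((K + 1 : ℕ) : ENNReal) * a (n + 1))
    (hb : ∀ n, a (n + 1) + ((K + 2 : ℕ) : ENNReal) * b (n + 1) ≤ b n) (hf : ∀ n, b n ≠ ⊤) (n : ℕ) :
    a n = 0 := by
  have key : ∀ j : ℕ, ∀ n, (j : ENNReal) * a n ≤ ((K + 1 : ℕ) : ENNReal) * b n := by
    intro j
    induction j with
    | zero => intro n; simp
    | succ j ih =>
      intro n
      calc ((j + 1 : ℕ) : ENNReal) * a n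
          ≤ ((j + 1 : ℕ) : ENNReal) * (((K + 1 : ℕ) : ENNReal) * a (n + 1)) := by
            gcongr; exact ha n
        _ = ((K + 1 : ℕ) : ENNReal) * a (n + 1)
            + ((K + 1 : ℕ) : ENNReal) * ((j : ENNReal) * a (n + 1)) := by
            push_cast; ring
        _ ≤ ((K + 1 : ℕ) : ENNReal) * a (n + 1)
            + ((K + 2 : ℕ) : ENNReal) * (((K + 1 : ℕ) : ENNReal) * b (n + 1)) := by
            refine add_le_add le_rfl (mul_le_mul' ?_ (ih _))
            exact_mod_cast Nat.le_succ (K + 1)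
        _ = ((K + 1 : ℕ) : ENNReal) * (a (n + 1) + ((K + 2 : ℕ) : ENNReal) * b (n + 1)) := by
            ring
        _ ≤ _ := by gcongr; exact hb n
  by_contra h0
  have hT : ((K + 1 : ℕ) : ENNReal) * b n ≠ ⊤ := ENNReal.mul_ne_top (ENNReal.natCast_ne_top _) (hf n)
  obtain ⟨j, hj⟩ := ENNReal.exists_nat_mul_gt h0 hT
  exact absurd (key j n) (not_le.2 hj)


/-- For the stationary generalized Bratteli diagram with vertex levels
`ℕ = {1, 2, …}` and incidence matrix `f_{kk} = k + 1`, `f_{k,k+1} = 1` (all other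
entries `0`), every tail-invariant Borel measure assigning finite values to all cylinder
sets is the zero measure. -/
theorem no_tail_invariant_measure_finite_on_cylinders (μ : Measure BD11.Path)
    (hinv : ∀ (n : ℕ) (p q : BD11.FinPath n), BD11.out p = BD11.out q →
      μ (BD11.cyl p) = μ (BD11.cyl q))
    (hfin : ∀ (n : ℕ) (p : BD11.FinPath n), μ (BD11.cyl p) ≠ ⊤)
    (hfin0 : ∀ w : BD11.Vtx, μ {x : BD11.Path | BD11.src (x.1 0) = w} ≠ ⊤) :
    μ = 0 := by
  have hk : ∀ K : ℕ, ∀ (n : ℕ) (p : BD11.FinPath n), (BD11.out p).1 = K → μ (BD11.cyl p) = 0 := by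
    intro K
    induction K using Nat.strong_induction_on with
    | _ K ih =>
      intro n p hp
      have hnull : ∀ (m : ℕ) (q : BD11.FinPath m), (BD11.out q).1 < (BD11.out p).1 →
          μ (BD11.cyl q) = 0 := fun m q hq => ih _ (hp ▸ hq) m q rfl
      rw [hinv n p (BD11.constP n (BD11.out p)) rfl]
      exact BD11.arith (BD11.out p).1 (fun n => μ (BD11.cyl (BD11.constP n (BD11.out p))))
        (fun n => μ (BD11.cyl (BD11.constP n (BD11.up (BD11.out p)))))
        (fun n => BD11.upper μ hinv _ hnull n) (fun n => BD11.lower μ hinv _ n)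
        (fun n => hfin _ _) n
  have hU : (⋃ p : BD11.FinPath 0, BD11.cyl p) = Set.univ :=
    Set.eq_univ_of_forall fun x => Set.mem_iUnion.2 ⟨BD11.trunc x 0, fun _ => rfl⟩
  rw [← Measure.measure_univ_eq_zero, ← hU]
  exact measure_iUnion_null fun p => hk _ 0 p rfl
end

section
/- Let A = (a_{ij})_{i,j∈ℕ} be a matrix with nonnegative integer entries for which there exist a real number λ > 0 and a vector ξ = (ξ_i) with ξ_i > 0 for all i such that for every i the series ∑_{j∈ℕ} a_{ij} ξ_j converges and equals λ ξ_i. If some row of A has only finitely many zero entries, then the eigenvector ξ is summable: ∑_{i∈ℕ} ξ_i < ∞. -/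
/-- Let `A = (a_{ij})_{i,j ∈ ℕ}` be a matrix with nonnegative integer
entries, `lam > 0` a real number and `ξ = (ξ_i)` a strictly positive vector such that
for every `i` the series `∑_j a_{ij} ξ_j` converges to `lam · ξ_i`. If some row of `A`
has only finitely many zero entries, then `∑_i ξ_i < ∞`. -/
theorem summable_eigenvector_of_row_with_finitely_many_zeros
    (A : ℕ → ℕ → ℕ) (lam : ℝ) (hlam : 0 < lam)
    (ξ : ℕ → ℝ) (hξ : ∀ i, 0 < ξ i)
    (heig : ∀ i, HasSum (fun j => (A i j : ℝ) * ξ j) (lam * ξ i))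
    (hrow : ∃ i, {j : ℕ | A i j = 0}.Finite) :
    Summable ξ := by
  obtain ⟨i, hi⟩ := hrow
  refine Summable.of_norm_bounded_eventually (heig i).summable ?_
  refine hi.subset ?_
  intro j hj
  by_contra h
  apply hj
  have h1 : (1 : ℝ) ≤ (A i j : ℝ) := by
    exact_mod_cast Nat.one_le_iff_ne_zero.mpr h
  change ‖ξ j‖ ≤ (A i j : ℝ) * ξ j
  rw [Real.norm_of_nonneg (hξ j).le]
  nlinarith [hξ j]
end

section
/- Let A = (a_{ij})_{i,j∈ℕ} be a matrix with nonnegative integer entries such that A ξ = λ ξ for some 0 < λ < ∞ and some vector ξ with ξ_i > 0 for all i (the series ∑_j a_{kj} ξ_j converging for each k). For each k∈ℕ put M_k = {j∈ℕ : a_{kj} > 0}. If there exists a finite collection of rows k_1, …, k_p such that the set ℕ ∖ (M_{k_1} ∪ … ∪ M_{k_p}) is finite, then ∑_{i∈ℕ} ξ_i < ∞. -/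
/-- Let `A = (a_{ij})_{i,j ∈ ℕ}` be a matrix with nonnegative integer
entries, `lam > 0` a real number and `ξ` a strictly positive vector with `A ξ = lam ξ`
entrywise (the series `∑_j a_{kj} ξ_j` converging for each `k`). For `k ∈ ℕ` put
`M_k = {j : a_{kj} > 0}`. If there is a finite collection of rows `k_1, …, k_p` such
that `ℕ ∖ (M_{k_1} ∪ ⋯ ∪ M_{k_p})` is finite, then `∑_i ξ_i < ∞`. -/
theorem summable_eigenvector_of_finitely_many_rows
    (A : ℕ → ℕ → ℕ) (lam : ℝ) (hlam : 0 < lam)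
    (ξ : ℕ → ℝ) (hξ : ∀ i, 0 < ξ i)
    (heig : ∀ k, HasSum (fun j => (A k j : ℝ) * ξ j) (lam * ξ k))
    (hrows : ∃ K : Finset ℕ, (Set.univ \ ⋃ k ∈ K, {j : ℕ | 0 < A k j}).Finite) :
    Summable ξ := by
  obtain ⟨K, hK⟩ := hrows
  have hS : Summable (fun j => ∑ k ∈ K, (A k j : ℝ) * ξ j) :=
    summable_sum (fun k _ => (heig k).summable)
  refine Summable.of_norm_bounded_eventually hS ?_
  refine hK.subset ?_
  intro j hj
  refine ⟨Set.mem_univ _, fun hmem => hj ?_⟩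
  simp only [Set.mem_iUnion, Set.mem_setOf_eq] at hmem
  obtain ⟨k, hk, hpos⟩ := hmem
  show ‖ξ j‖ ≤ ∑ k ∈ K, (A k j : ℝ) * ξ j
  rw [Real.norm_of_nonneg (hξ j).le]
  have h1 : (1 : ℝ) ≤ (A k j : ℝ) := by exact_mod_cast hpos
  have h2 : (A k j : ℝ) * ξ j ≤ ∑ k ∈ K, (A k j : ℝ) * ξ j :=
    Finset.single_le_sum (f := fun k => (A k j : ℝ) * ξ j)
      (fun i _ => mul_nonneg (Nat.cast_nonneg _) (hξ j).le) hk
  exact le_trans (le_mul_of_one_le_left (hξ j).le h1) h2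
end

section
/- Let B be a generalized Bratteli diagram with incidence matrices (F_n) and A_n = F_n^T, in which every vertex emits at least two edges, and let μ be a tail-invariant probability measure on X_B that takes positive values on all cylinder sets. Then there exist real numbers λ_n > 1, vectors μ̂^{(n)} = (μ̂^{(n)}_v)_{v∈V_n} and vectors Ĥ^{(n)} = (Ĥ^{(n)}_v)_{v∈V_n} such that for every n≥0: (1) ∑_{v∈V_n} μ̂^{(n)}_v Ĥ^{(n)}_v = 1; (2) A_n μ̂^{(n+1)} = λ_n μ̂^{(n)}; (3) F_n Ĥ^{(n)} = λ_n Ĥ^{(n+1)}. Conversely, if (A_n) is a sequence of countably infinite matrices with nonnegative integer entries, no zero rows or columns, and finitely many nonzero entries in each column, and there exist numbers λ_n > 1, nonnegative vectors μ̂^{(n)} and strictly positive vectors Ĥ^{(n)} with Ĥ^{(0)} ≡ 1 satisfying (1), (2) and (3), then the generalized Bratteli diagram B with incidence matrices F_n = A_n^T possesses a tail-invariant probability measure μ whose values on cylinder sets are given by μ([ē]) = μ̂^{(0)}_w when ē is the empty path at w∈V_0, and μ([ē]) = μ̂^{(n)}_w / (λ_0 λ_1 ⋯ λ_{n−1}) for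 every finite path ē = (e_0,…,e_{n−1}), n ≥ 1, with range w∈V_n. -/
open Set

/-- A generalized Bratteli diagram: countably infinite vertex levels `V n`, countable
edge levels `E n` with source and range maps, such that every vertex emits an edge,
every vertex of level `n ≥ 1` receives an edge, and every vertex receives only finitely
many edges. -/
structure GBD where
  /-- the vertices of level `n` -/
  V : ℕ → Type
  /-- the edges between level `n` and level `n + 1` -/
  E : ℕ → Type
  countV : ∀ n, Countable (V n)
  infV : ∀ n, Infinite (V n)
  countE : ∀ n, Countable (E n)
  src : (n : ℕ) → E n → V n
  rng : (n : ℕ) → E n → V (n + 1)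
  src_surj : ∀ (n : ℕ) (v : V n), ∃ e : E n, src n e = v
  rng_surj : ∀ (n : ℕ) (v : V (n + 1)), ∃ e : E n, rng n e = v
  rng_fin : ∀ (n : ℕ) (v : V (n + 1)), {e : E n | rng n e = v}.Finite

namespace GBD

variable (B : GBD)

/-- The path space `X_B`: infinite sequences of composable edges. -/
def Path := { x : (n : ℕ) → B.E n // ∀ n, B.src (n + 1) (x (n + 1)) = B.rng n (x n) }

/-- The topology on the path space, generated by cylinder sets: the topology induced
from the product of the discrete topologies on the edge sets. -/
instance : TopologicalSpace B.Path :=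
  TopologicalSpace.induced (fun x : B.Path => x.1)
    (@Pi.topologicalSpace ℕ (fun n => B.E n) (fun _ => ⊥))

/-- The Borel σ-algebra on the path space. -/
instance : MeasurableSpace B.Path := borel B.Path

/-- A finite path from level `0` to level `n + 1` (a sequence of `n + 1` composable edges). -/
def FinPath (n : ℕ) :=
  { p : (i : Fin (n + 1)) → B.E i //
    ∀ i : Fin n, B.src (i.1 + 1) (p i.succ) = B.rng i.1 (p i.castSucc) }

/-- The range of a finite path: a vertex of level `n + 1`. -/
def FinPath.out {n : ℕ} (p : B.FinPath n) : B.V (n + 1) := B.rng n (p.1 (Fin.last n))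

/-- The cylinder set of a finite path. -/
def cyl {n : ℕ} (p : B.FinPath n) : Set B.Path :=
  { x : B.Path | ∀ i : Fin (n + 1), x.1 i.1 = p.1 i }

/-- Two infinite paths are tail equivalent if they eventually agree. -/
def TailEquiv (x y : B.Path) : Prop := ∃ N : ℕ, ∀ n, N ≤ n → x.1 n = y.1 n

/-- An order on a Bratteli diagram: a partial order on each edge set such that two edges
are comparable iff they have the same range, and which is linear on each set `r⁻¹(v)`. -/
structure EdgeOrder where
  le : (n : ℕ) → B.E n → B.E n → Prop
  le_rng : ∀ n e f, le n e f → B.rng n e = B.rng n f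
  le_refl : ∀ n e, le n e e
  le_antisymm : ∀ n e f, le n e f → le n f e → e = f
  le_trans : ∀ n e f g, le n e f → le n f g → le n e g
  le_total : ∀ n e f, B.rng n e = B.rng n f → le n e f ∨ le n f e

/-- An edge is maximal if it is the largest element of `r⁻¹(r(e))`. -/
def IsMaxEdge (ω : B.EdgeOrder) (n : ℕ) (e : B.E n) : Prop :=
  ∀ f : B.E n, B.rng n f = B.rng n e → ω.le n f e

/-- An edge is minimal if it is the smallest element of `r⁻¹(r(e))`. -/
def IsMinEdge (ω : B.EdgeOrder) (n : ℕ) (e : B.E n) : Prop :=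
  ∀ f : B.E n, B.rng n f = B.rng n e → ω.le n e f

/-- An infinite path is maximal if all of its edges are maximal. -/
def IsMaxPath (ω : B.EdgeOrder) (x : B.Path) : Prop := ∀ n, B.IsMaxEdge ω n (x.1 n)

/-- An infinite path is minimal if all of its edges are minimal. -/
def IsMinPath (ω : B.EdgeOrder) (x : B.Path) : Prop := ∀ n, B.IsMinEdge ω n (x.1 n)

/-- `f` is the successor of `e` in the linearly ordered set `r⁻¹(r(e))`. -/
def IsSuccEdge (ω : B.EdgeOrder) (n : ℕ) (e f : B.E n) : Prop :=
  ω.le n e f ∧ e ≠ f ∧ ∀ g : B.E n, ω.le n e g → g ≠ e → ω.le n f g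

/-- `y` is the image of `x` under the canonical Vershik map: the first non-maximal edge
`x m` is replaced by its successor, the edges above level `m` are unchanged, and the
initial segment is replaced by the minimal finite path (all of whose edges are minimal). -/
def VershikRel (ω : B.EdgeOrder) (x y : B.Path) : Prop :=
  ∃ m : ℕ, (∀ i, i < m → B.IsMaxEdge ω i (x.1 i)) ∧ ¬ B.IsMaxEdge ω m (x.1 m) ∧
    B.IsSuccEdge ω m (x.1 m) (y.1 m) ∧ (∀ i, m < i → y.1 i = x.1 i) ∧
    ∀ i, i < m → B.IsMinEdge ω i (y.1 i)

end GBD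

open MeasureTheory
open scoped ENNReal

namespace GBD

variable (B : GBD)

/-- The entry `a^{(n)}_{w v}` of the matrix `A_n = F_nᵀ`: the number of edges from the
vertex `w` of level `n` to the vertex `v` of level `n + 1`, viewed in `ℝ≥0∞`. -/
noncomputable def cnt (n : ℕ) (w : B.V n) (v : B.V (n + 1)) : ℝ≥0∞ :=
  (Nat.card {e : B.E n // B.src n e = w ∧ B.rng n e = v} : ℝ≥0∞)

/-- A measure is tail-invariant if cylinder sets over finite paths with the same range
have equal measure. -/
def TailInvariant (μ : Measure B.Path) : Prop :=
  ∀ (n : ℕ) (p q : B.FinPath n), p.out = q.out → μ (B.cyl p) = μ (B.cyl q)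

end GBD

namespace GBD

lemma cnt_mul (B : GBD) (n : ℕ) (w : B.V n) (v : B.V (n + 1)) (g : ℝ≥0∞) :
    B.cnt n w v * g = ∑' e : B.E n, Set.indicator {e | B.src n e = w ∧ B.rng n e = v} (fun _ => g) e := by
  rw [← tsum_subtype {e | B.src n e = w ∧ B.rng n e = v} (fun _ => g)]
  have hf : {e | B.src n e = w ∧ B.rng n e = v}.Finite :=
    (B.rng_fin n v).subset (fun e he => he.2)
  haveI := hf.fintype
  rw [tsum_fintype, Finset.sum_const, nsmul_eq_mul, cnt]
  congr 2
  exact Nat.card_eq_fintype_card (α := ↥{e | B.src n e = w ∧ B.rng n e = v})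

open Classical in
lemma tsum_cnt_rng (B : GBD) (n : ℕ) (w : B.V n) (g : B.V (n + 1) → ℝ≥0∞) :
    ∑' v, B.cnt n w v * g v = ∑' e, if B.src n e = w then g (B.rng n e) else 0 := by
  simp_rw [cnt_mul]
  rw [ENNReal.tsum_comm]
  refine tsum_congr fun e => ?_
  rw [tsum_eq_single (B.rng n e)]
  · by_cases h : B.src n e = w <;> simp [h]
  · intro v hv
    simp [Ne.symm hv]

open Classical in
lemma tsum_cnt_src (B : GBD) (n : ℕ) (v : B.V (n + 1)) (g : B.V n → ℝ≥0∞) :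
    ∑' w, B.cnt n w v * g w = ∑' e, if B.rng n e = v then g (B.src n e) else 0 := by
  simp_rw [cnt_mul]
  rw [ENNReal.tsum_comm]
  refine tsum_congr fun e => ?_
  rw [tsum_eq_single (B.src n e)]
  · by_cases h : B.rng n e = v <;> simp [h]
  · intro v hv
    simp [Ne.symm hv]

open Classical in
/-- repair a sequence of edges into a path -/
noncomputable def repair (B : GBD) (z : (n : ℕ) → B.E n) : (n : ℕ) → B.E n
  | 0 => z 0
  | n + 1 => if B.src (n + 1) (z (n + 1)) = B.rng n (repair B z n) then z (n + 1)
      else (B.src_surj (n + 1) (B.rng n (repair B z n))).choose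

lemma exists_path (B : GBD) (z : (n : ℕ) → B.E n) (N : ℕ)
    (hz : ∀ i < N, B.src (i + 1) (z (i + 1)) = B.rng i (z i)) :
    ∃ x : B.Path, ∀ i ≤ N, x.1 i = z i := by
  refine ⟨⟨B.repair z, fun n => ?_⟩, ?_⟩
  · rw [repair]
    split_ifs with h
    · exact h
    · exact (B.src_surj (n + 1) (B.rng n (repair B z n))).choose_spec
  · intro i
    induction i with
    | zero => intro _; rfl
    | succ k ih =>
      intro hk
      have := ih (by omega)
      change B.repair z k = z k at this
      change B.repair z (k + 1) = z (k + 1)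
      rw [repair, if_pos (by rw [this]; exact hz k (by omega))]

lemma exists_edges (B : GBD) : Nonempty ((n : ℕ) → B.E n) :=
  ⟨fun n => (B.src_surj n ((B.infV n).nonempty.some)).choose⟩

/-- the cylinder of a path -/
def C (B : GBD) (n : ℕ) (x : B.Path) : Set B.Path := {y | ∀ i ≤ n, y.1 i = x.1 i}

/-- truncation of a path -/
def trunc (B : GBD) (n : ℕ) (x : B.Path) : B.FinPath n :=
  ⟨fun i => x.1 i, fun i => x.2 i⟩

lemma cyl_trunc (B : GBD) (n : ℕ) (x : B.Path) : B.cyl (B.trunc n x) = B.C n x := by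
  ext y
  constructor
  · intro h i hi
    exact h ⟨i, by omega⟩
  · intro h i
    exact h i.1 (by omega)

lemma exists_trunc (B : GBD) (n : ℕ) (p : B.FinPath n) : ∃ x, B.trunc n x = p := by
  obtain ⟨z⟩ := B.exists_edges
  obtain ⟨x, hx⟩ := B.exists_path (fun i => if h : i < n + 1 then p.1 ⟨i, h⟩ else z i) n (by
    intro i hi
    have h1 : i + 1 < n + 1 := by omega
    have h2 : i < n + 1 := by omega
    simp only [h1, h2, dif_pos]
    exact p.2 ⟨i, hi⟩)
  refine ⟨x, Subtype.ext (funext fun i => ?_)⟩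
  have := hx i (by omega)
  rw [dif_pos i.2] at this
  exact this

lemma exists_first (B : GBD) (e : B.E 0) : ∃ x : B.Path, x.1 0 = e := by
  obtain ⟨z⟩ := B.exists_edges
  obtain ⟨x, hx⟩ := B.exists_path (Function.update z 0 e) 0 (by simp)
  exact ⟨x, by rw [hx 0 le_rfl]; simp⟩

lemma exists_next (B : GBD) (n : ℕ) (x : B.Path) (e : B.E (n + 1))
    (he : B.src (n + 1) e = B.rng n (x.1 n)) :
    ∃ y : B.Path, (∀ i ≤ n, y.1 i = x.1 i) ∧ y.1 (n + 1) = e := by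
  obtain ⟨y, hy⟩ := B.exists_path (Function.update x.1 (n + 1) e) (n + 1) (by
    intro i hi
    rw [Function.update_of_ne (show i ≠ n + 1 by omega)]
    by_cases h : i = n
    · subst h; simp [he]
    · rw [Function.update_of_ne (by omega)]; exact x.2 i)
  refine ⟨y, fun i hi => ?_, ?_⟩
  · rw [hy i (by omega), Function.update_of_ne (by omega)]
  · rw [hy _ le_rfl]; simp

lemma exists_reach (B : GBD) (n : ℕ) (v : B.V (n + 1)) : ∃ x : B.Path, B.rng n (x.1 n) = v := by
  induction n with
  | zero =>
    obtain ⟨e, rfl⟩ := B.rng_surj 0 v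
    obtain ⟨x, hx⟩ := B.exists_first e
    exact ⟨x, by rw [hx]⟩
  | succ n ih =>
    obtain ⟨e, rfl⟩ := B.rng_surj (n + 1) v
    obtain ⟨x, hx⟩ := ih (B.src (n + 1) e)
    obtain ⟨y, _, hy⟩ := B.exists_next n x e hx.symm
    exact ⟨y, by rw [hy]⟩

lemma meas_coord (B : GBD) (n : ℕ) (S : Set (B.E n)) :
    MeasurableSet {x : B.Path | x.1 n ∈ S} := by
  letI : ∀ n, TopologicalSpace (B.E n) := fun _ => ⊥
  haveI : ∀ n, DiscreteTopology (B.E n) := fun _ => ⟨rfl⟩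
  have : IsOpen {x : B.Path | x.1 n ∈ S} :=
    isOpen_induced ((isOpen_discrete S).preimage (continuous_apply (A := B.E) n))
  exact MeasurableSpace.measurableSet_generateFrom this

lemma meas_C (B : GBD) (n : ℕ) (x : B.Path) : MeasurableSet (B.C n x) := by
  have : B.C n x = ⋂ i : ℕ, ⋂ _ : i ≤ n, {y | y.1 i ∈ ({x.1 i} : Set (B.E i))} := by
    ext y; simp [C]
  rw [this]
  exact MeasurableSet.iInter fun i => MeasurableSet.iInter fun _ => B.meas_coord i _

lemma measure_split (B : GBD) (μ : Measure B.Path) (n : ℕ) (S : Set B.Path)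
    (hS : MeasurableSet S) : μ S = ∑' e : B.E n, μ (S ∩ {x | x.1 n = e}) := by
  haveI := B.countE n
  rw [← measure_iUnion]
  · congr 1; ext x; simp
  · intro e f hef
    rw [Function.onFun, Set.disjoint_left]
    rintro x ⟨_, h1⟩ ⟨_, h2⟩
    exact hef (h1.symm.trans h2)
  · intro e
    exact hS.inter (B.meas_coord n {e})

/-- measure of the tower at a vertex -/
noncomputable def m (B : GBD) (μ : Measure B.Path) : (n : ℕ) → B.V n → ℝ≥0∞
  | 0, w => μ {x : B.Path | B.src 0 (x.1 0) = w}
  | n + 1, v => μ (B.C n (B.exists_reach n v).choose)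

lemma m_succ (B : GBD) (μ : Measure B.Path) (h : B.TailInvariant μ) (n : ℕ) (x : B.Path) :
    B.m μ (n + 1) (B.rng n (x.1 n)) = μ (B.C n x) := by
  rw [m, ← cyl_trunc, ← cyl_trunc]
  exact h n _ _ (B.exists_reach n (B.rng n (x.1 n))).choose_spec

open Classical in
lemma m_rec (B : GBD) (μ : Measure B.Path) (h : B.TailInvariant μ) (n : ℕ) (w : B.V n) :
    ∑' e, (if B.src n e = w then B.m μ (n + 1) (B.rng n e) else 0) = B.m μ n w := by
  cases n with
  | zero =>
    have hS : MeasurableSet {x : B.Path | B.src 0 (x.1 0) = w} :=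
      B.meas_coord 0 {e | B.src 0 e = w}
    rw [m, B.measure_split μ 0 _ hS]
    refine tsum_congr fun e => ?_
    split_ifs with he
    · obtain ⟨x, rfl⟩ := B.exists_first e
      rw [B.m_succ μ h]
      congr 1
      ext y
      simp only [C, Set.mem_setOf_eq, Set.mem_inter_iff]
      constructor
      · intro hy
        have := hy 0 le_rfl
        exact ⟨by rw [this]; exact he, this⟩
      · rintro ⟨_, hy⟩ i hi
        obtain rfl : i = 0 := by omega
        exact hy
    · symm
      convert measure_empty (μ := μ)
      ext y
      simp only [Set.mem_setOf_eq, Set.mem_inter_iff, Set.mem_empty_iff_false, iff_false]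
      rintro ⟨h1, rfl⟩
      exact he h1
  | succ n =>
    obtain ⟨x, rfl⟩ := B.exists_reach n w
    rw [B.m_succ μ h, B.measure_split μ (n + 1) _ (B.meas_C n x)]
    refine tsum_congr fun e => ?_
    split_ifs with he
    · obtain ⟨z, hz, rfl⟩ := B.exists_next n x e he
      rw [B.m_succ μ h]
      congr 1
      ext y
      simp only [C, Set.mem_setOf_eq, Set.mem_inter_iff]
      constructor
      · intro hy
        exact ⟨fun i hi => (hy i (by omega)).trans (hz i hi), hy _ le_rfl⟩
      · rintro ⟨h1, h2⟩ i hi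
        by_cases hin : i ≤ n
        · rw [h1 i hin, hz i hin]
        · obtain rfl : i = n + 1 := by omega
          exact h2
    · symm
      convert measure_empty (μ := μ)
      ext y
      simp only [C, Set.mem_setOf_eq, Set.mem_inter_iff, Set.mem_empty_iff_false, iff_false]
      rintro ⟨h1, rfl⟩
      exact he ((y.2 n).trans (by rw [h1 n le_rfl]))

lemma tsum_m_zero (B : GBD) (μ : Measure B.Path) [IsProbabilityMeasure μ] :
    ∑' w, B.m μ 0 w = 1 := by
  haveI := B.countV 0
  simp only [m]
  rw [← measure_iUnion, ← measure_univ (μ := μ)]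
  · congr 1; ext x; simp
  · intro e f hef
    rw [Function.onFun, Set.disjoint_left]
    intro x h1 h2
    exact hef (h1.symm.trans h2)
  · intro w
    exact B.meas_coord 0 {e | B.src 0 e = w}

/-- heights -/
noncomputable def ht (B : GBD) : (n : ℕ) → B.V n → ℝ≥0∞
  | 0, _ => 1
  | n + 1, v => ∑' w, B.cnt n w v * ht B n w

lemma ht_ne_top (B : GBD) (n : ℕ) (v : B.V n) : B.ht n v ≠ ⊤ := by
  classical
  induction n with
  | zero => simp [ht]
  | succ n ih =>
    rw [ht, tsum_cnt_src, tsum_eq_sum (s := (B.rng_fin n v).toFinset)]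
    · refine ENNReal.sum_ne_top.2 fun e _ => ?_
      split_ifs
      · exact ih _
      · simp
    · intro e he
      rw [if_neg]
      simpa using he

lemma forward (B : GBD) (μ : Measure B.Path) (hp : IsProbabilityMeasure μ)
    (h : B.TailInvariant μ) :
    ∃ (lam : ℕ → ℝ≥0∞) (mu : (n : ℕ) → B.V n → ℝ≥0∞) (H : (n : ℕ) → B.V n → ℝ≥0∞),
          (∀ n, 1 < lam n ∧ lam n ≠ ⊤) ∧
          (∀ (n : ℕ) (v : B.V n), mu n v ≠ ⊤) ∧
          (∀ (n : ℕ) (v : B.V n), H n v ≠ ⊤) ∧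
          (∀ n : ℕ, ∑' v : B.V n, mu n v * H n v = 1) ∧
          (∀ (n : ℕ) (w : B.V n),
            ∑' v : B.V (n + 1), B.cnt n w v * mu (n + 1) v = lam n * mu n w) ∧
          (∀ (n : ℕ) (v : B.V (n + 1)),
            ∑' w : B.V n, B.cnt n w v * H n w = lam n * H (n + 1) v) := by
  classical
  have key : ∀ n (w : B.V n), ∑' v, B.cnt n w v * B.m μ (n + 1) v = B.m μ n w := by
    intro n w
    rw [tsum_cnt_rng, B.m_rec μ h]
  have hinv : ∀ n : ℕ, (2 : ℝ≥0∞) ^ n * (2 ^ n)⁻¹ = 1 := fun n =>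
    ENNReal.mul_inv_cancel (by simp) (by simp)
  refine ⟨fun _ => 2, fun n v => 2 ^ n * B.m μ n v, fun n v => (2 ^ n)⁻¹ * B.ht n v, ?_, ?_, ?_,
    ?_, ?_, ?_⟩
  · intro n; exact ⟨by norm_num, by norm_num⟩
  · intro n v
    refine ENNReal.mul_ne_top (by simp) ?_
    cases n <;> exact measure_ne_top _ _
  · intro n v
    exact ENNReal.mul_ne_top (by simp) (B.ht_ne_top n v)
  · intro n
    have : ∀ v, 2 ^ n * B.m μ n v * ((2 ^ n)⁻¹ * B.ht n v) = B.m μ n v * B.ht n v := by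
      intro v
      calc _ = (2 ^ n * (2 ^ n)⁻¹) * (B.m μ n v * B.ht n v) := by ring
        _ = _ := by rw [hinv, one_mul]
    simp_rw [this]
    induction n with
    | zero => simpa [ht] using B.tsum_m_zero μ
    | succ n ih =>
      rw [← ih (fun v => by
        calc _ = (2 ^ n * (2 ^ n)⁻¹) * (B.m μ n v * B.ht n v) := by ring
          _ = _ := by rw [hinv, one_mul])]
      simp_rw [ht, ← ENNReal.tsum_mul_left]
      rw [ENNReal.tsum_comm]
      refine tsum_congr fun w => ?_
      rw [← key n w, ← ENNReal.tsum_mul_right]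
      exact tsum_congr fun v => by ring
  · intro n w
    dsimp only
    rw [← key n w, ← ENNReal.tsum_mul_left, ← ENNReal.tsum_mul_left]
    exact tsum_congr fun v => by ring
  · intro n v
    dsimp only
    rw [ht, ← ENNReal.tsum_mul_left, ← ENNReal.tsum_mul_left]
    refine tsum_congr fun w => ?_
    have : (2 : ℝ≥0∞) * (2 ^ (n + 1))⁻¹ = (2 ^ n)⁻¹ := by
      rw [pow_succ, ENNReal.mul_inv (by simp) (by simp), mul_comm, mul_assoc,
        ENNReal.inv_mul_cancel (by simp) (by simp), mul_one]
    rw [← this]; ring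

/-! ### The converse -/

/-- edges starting at a vertex -/
abbrev Out (B : GBD) (i : Σ n, B.V n) : Type := {e : B.E i.1 // B.src i.1 e = i.2}

/-- choices of an edge at each vertex -/
abbrev Choice (B : GBD) : Type := (i : Σ n, B.V n) → B.Out i

/-- the vertex of level `n` reached by following the choices -/
def vert (B : GBD) (a : B.V 0 × B.Choice) : (n : ℕ) → B.V n
  | 0 => a.1
  | n + 1 => B.rng n (a.2 ⟨n, vert B a n⟩).1

/-- the path following the choices -/
def follow (B : GBD) (a : B.V 0 × B.Choice) : B.Path :=
  ⟨fun n => (a.2 ⟨n, B.vert a n⟩).1, fun n => (a.2 ⟨n + 1, B.vert a (n + 1)⟩).2⟩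

lemma follow_mem_C (B : GBD) (a : B.V 0 × B.Choice) (n : ℕ) (x : B.Path) :
    B.follow a ∈ B.C n x ↔ a.1 = B.src 0 (x.1 0) ∧
      ∀ i ≤ n, (a.2 ⟨i, B.src i (x.1 i)⟩).1 = x.1 i := by
  constructor
  · intro h
    have hv : ∀ i ≤ n, B.vert a i = B.src i (x.1 i) := by
      intro i hi
      rw [← h i hi]
      exact (a.2 ⟨i, B.vert a i⟩).2.symm
    refine ⟨hv 0 (by omega), fun i hi => ?_⟩
    rw [← hv i hi]
    exact h i hi
  · rintro ⟨h0, h⟩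
    have hv : ∀ i ≤ n, B.vert a i = B.src i (x.1 i) := by
      intro i
      induction i with
      | zero => intro _; exact h0
      | succ k ih =>
        intro hk
        rw [vert, ih (by omega), h k (by omega), x.2 k]
    intro i hi
    change (a.2 ⟨i, B.vert a i⟩).1 = x.1 i
    rw [hv i hi]
    exact h i hi

lemma measurable_follow (B : GBD) [MeasurableSpace (B.V 0)] [MeasurableSingletonClass (B.V 0)]
    [∀ i, MeasurableSpace (B.Out i)]
    [∀ i, DiscreteMeasurableSpace (B.Out i)] : Measurable B.follow := by
  haveI := B.countV
  haveI := B.countE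
  have hs : ∀ n (v : B.V n), MeasurableSet {a | B.vert a n = v} → ∀ e : B.E n,
      MeasurableSet {a : B.V 0 × B.Choice | B.vert a n = v ∧ (a.2 ⟨n, v⟩).1 = e} := by
    intro n v h e
    refine h.inter ?_
    have : Measurable fun a : B.V 0 × B.Choice => a.2 ⟨n, v⟩ :=
      (measurable_pi_apply _).comp measurable_snd
    exact this (MeasurableSet.of_discrete (s := {y : B.Out ⟨n, v⟩ | y.1 = e}))
  have he : ∀ n, (∀ v : B.V n, MeasurableSet {a | B.vert a n = v}) → ∀ e : B.E n,
      MeasurableSet {a | (B.follow a).1 n = e} := by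
    intro n h e
    have : {a | (B.follow a).1 n = e} =
        ⋃ v : B.V n, {a : B.V 0 × B.Choice | B.vert a n = v ∧ (a.2 ⟨n, v⟩).1 = e} := by
      ext a
      simp [follow]
    rw [this]
    exact MeasurableSet.iUnion fun v => hs n v (h v) e
  have hv : ∀ n (v : B.V n), MeasurableSet {a | B.vert a n = v} := by
    intro n
    induction n with
    | zero => intro v; exact measurable_fst (measurableSet_singleton v)
    | succ n ih =>
      intro v
      have : {a | B.vert a (n + 1) = v} =
          ⋃ e : B.E n, ⋃ _ : B.rng n e = v, {a | (B.follow a).1 n = e} := by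
        ext a
        simp [follow, vert]
      rw [this]
      exact MeasurableSet.iUnion fun e => MeasurableSet.iUnion fun _ => he n ih e
  letI : ∀ n, TopologicalSpace (B.E n) := fun _ => ⊥
  haveI : ∀ n, DiscreteTopology (B.E n) := fun _ => ⟨rfl⟩
  letI : ∀ n, MeasurableSpace (B.E n) := fun _ => borel _
  haveI : ∀ n, BorelSpace (B.E n) := fun _ => ⟨rfl⟩
  have hm : Measurable fun a => (B.follow a).1 := by
    refine measurable_pi_iff.2 fun n => ?_
    refine measurable_to_countable' fun e => ?_
    exact he n (hv n) e
  refine measurable_generateFrom (fun U hU => ?_)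
  obtain ⟨W, hW, rfl⟩ := isOpen_induced_iff.1 (show IsOpen U from hU)
  exact hm hW.measurableSet

lemma exists_pmf (B : GBD) (lam : ℕ → ℝ≥0∞) (mu : (n : ℕ) → B.V n → ℝ≥0∞)
    (hl : ∀ n, 1 < lam n ∧ lam n ≠ ⊤) (hmu : ∀ (n : ℕ) (v : B.V n), mu n v ≠ ⊤)
    (h2 : ∀ (n : ℕ) (w : B.V n),
        ∑' v : B.V (n + 1), B.cnt n w v * mu (n + 1) v = lam n * mu n w)
    (i : Σ n, B.V n) :
    ∃ p : PMF (B.Out i), ∀ e, mu i.1 i.2 * p e = mu (i.1 + 1) (B.rng i.1 e.1) / lam i.1 := by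
  classical
  obtain ⟨n, v⟩ := i
  have hl0 : lam n ≠ 0 := (lt_trans one_pos (hl n).1).ne'
  have hlt := (hl n).2
  have hsum : ∑' e : B.Out ⟨n, v⟩, mu (n + 1) (B.rng n e.1) = lam n * mu n v := by
    rw [← h2 n v, tsum_cnt_rng]
    refine (tsum_subtype {e | B.src n e = v} (fun e => mu (n + 1) (B.rng n e))).trans ?_
    exact tsum_congr fun e => by simp [Set.indicator_apply]
  by_cases h0 : mu n v = 0
  · obtain ⟨e, he⟩ := B.src_surj n v
    refine ⟨PMF.pure ⟨e, he⟩, fun f => ?_⟩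
    rw [h0, mul_zero, ENNReal.tsum_eq_zero] at hsum
    simp only [h0, zero_mul, hsum f, ENNReal.zero_div]
  · have hne : lam n * mu n v ≠ 0 := mul_ne_zero hl0 h0
    have hnt : lam n * mu n v ≠ ⊤ := ENNReal.mul_ne_top hlt (hmu n v)
    refine ⟨⟨fun e => mu (n + 1) (B.rng n e.1) * (lam n * mu n v)⁻¹, ?_⟩, fun e => ?_⟩
    · rw [← ENNReal.mul_inv_cancel hne hnt]
      nth_rewrite 2 [← hsum]
      rw [← ENNReal.tsum_mul_right]
      exact ENNReal.summable.hasSum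
    · change mu n v * (mu (n + 1) (B.rng n e.1) * (lam n * mu n v)⁻¹) = _
      rw [ENNReal.mul_inv (Or.inl hl0) (Or.inl hlt), ENNReal.div_eq_inv_mul]
      calc _ = (mu n v * (mu n v)⁻¹) * ((lam n)⁻¹ * mu (n + 1) (B.rng n e.1)) := by ring
        _ = _ := by rw [ENNReal.mul_inv_cancel h0 (hmu n v), one_mul]

lemma backward (B : GBD) (lam : ℕ → ℝ≥0∞) (mu : (n : ℕ) → B.V n → ℝ≥0∞)
    (hl : ∀ n, 1 < lam n ∧ lam n ≠ ⊤) (hmu : ∀ (n : ℕ) (v : B.V n), mu n v ≠ ⊤)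
    (h1 : ∑' v, mu 0 v = 1)
    (h2 : ∀ (n : ℕ) (w : B.V n),
        ∑' v : B.V (n + 1), B.cnt n w v * mu (n + 1) v = lam n * mu n w) :
    ∃ μ : Measure B.Path, B.TailInvariant μ ∧ IsProbabilityMeasure μ ∧
        (∀ w : B.V 0, μ {x : B.Path | B.src 0 (x.1 0) = w} = mu 0 w) ∧
        ∀ (n : ℕ) (p : B.FinPath n),
          μ (B.cyl p) = mu (n + 1) p.out / ∏ i ∈ Finset.range (n + 1), lam i := by
  classical
  choose p hp using B.exists_pmf lam mu hl hmu h2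
  letI : MeasurableSpace (B.V 0) := ⊤
  letI : ∀ i, MeasurableSpace (B.Out i) := fun _ => ⊤
  let p0 : PMF (B.V 0) := ⟨mu 0, by rw [← h1]; exact ENNReal.summable.hasSum⟩
  let Q : Measure B.Choice := Measure.infinitePi fun i => (p i).toMeasure
  have hf := B.measurable_follow
  let μ : Measure B.Path := (p0.toMeasure.prod Q).map B.follow
  have hC : ∀ n x, μ (B.C n x) =
      mu (n + 1) (B.rng n (x.1 n)) / ∏ i ∈ Finset.range (n + 1), lam i := by
    intro n x
    rw [Measure.map_apply hf (B.meas_C n x)]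
    let ι : ℕ → Σ n, B.V n := fun i => ⟨i, B.src i (x.1 i)⟩
    have hι : Function.Injective ι := fun i j h => congrArg Sigma.fst h
    let T : (i : Σ n, B.V n) → Set (B.Out i) := fun i => {e | e.1 = x.1 i.1}
    have hset : B.follow ⁻¹' (B.C n x) =
        {B.src 0 (x.1 0)} ×ˢ Set.pi ((Finset.range (n + 1)).image ι) T := by
      ext a
      rw [Set.mem_preimage, follow_mem_C]
      simp [Set.mem_pi, ι, T, Nat.lt_succ_iff]
    rw [hset, Measure.prod_prod, Measure.infinitePi_pi _ (fun i _ => MeasurableSet.of_discrete),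
      Finset.prod_image (fun i _ j _ h => hι h)]
    have hT : ∀ i, (p (ι i)).toMeasure (T (ι i)) = p (ι i) ⟨x.1 i, rfl⟩ := by
      intro i
      rw [← PMF.toMeasure_apply_singleton _ _ MeasurableSet.of_discrete]
      congr 1
      ext e
      simp [T, Subtype.ext_iff, ι]
    rw [PMF.toMeasure_apply_singleton _ _ MeasurableSet.of_discrete]
    change mu 0 _ * _ = _
    have main : ∀ k, mu 0 (B.src 0 (x.1 0)) * ∏ i ∈ Finset.range k, (p (ι i)).toMeasure (T (ι i)) =
        mu k (B.src k (x.1 k)) / ∏ i ∈ Finset.range k, lam i := by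
      intro k
      induction k with
      | zero => simp
      | succ k ih =>
        rw [Finset.prod_range_succ, ← mul_assoc, ih, hT, Finset.prod_range_succ, x.2 k]
        have h3 := hp (ι k) ⟨x.1 k, rfl⟩
        change mu k (B.src k (x.1 k)) * _ = mu (k + 1) (B.rng k (x.1 k)) / lam k at h3
        rw [div_eq_mul_inv, mul_right_comm, h3, div_eq_mul_inv, div_eq_mul_inv,
          ENNReal.mul_inv (Or.inr (hl k).2) (Or.inr (lt_trans one_pos (hl k).1).ne')]
        ring
    rw [main, x.2 n]
  have hcyl : ∀ (n : ℕ) (p : B.FinPath n),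
          μ (B.cyl p) = mu (n + 1) p.out / ∏ i ∈ Finset.range (n + 1), lam i := by
    intro n q
    obtain ⟨x, rfl⟩ := B.exists_trunc n q
    rw [cyl_trunc, hC]
    rfl
  refine ⟨μ, ?_, ?_, ?_, hcyl⟩
  · intro n q r h
    rw [hcyl, hcyl, h]
  · exact Measure.isProbabilityMeasure_map hf.aemeasurable
  · intro w
    have hS : MeasurableSet {x : B.Path | B.src 0 (x.1 0) = w} :=
      B.meas_coord 0 {e | B.src 0 e = w}
    rw [Measure.map_apply hf hS]
    have : B.follow ⁻¹' {x | B.src 0 (x.1 0) = w} = {w} ×ˢ Set.univ := by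
      ext a
      have : B.src 0 ((B.follow a).1 0) = a.1 := (a.2 ⟨0, a.1⟩).2
      simp [this]
    refine (congrArg _ this).trans ?_
    rw [Measure.prod_prod, measure_univ, mul_one,
      PMF.toMeasure_apply_singleton _ _ MeasurableSet.of_discrete]
    rfl

end GBD

/-- Let `B` be a generalized Bratteli diagram with incidence matrices
`(F_n)` and `A_n = F_nᵀ`, in which every vertex emits at least two edges, and let `μ` be
a tail-invariant probability measure on `X_B` taking positive values on all cylinder
sets. Then there are numbers `λ_n > 1` and vectors `μ̂⁽ⁿ⁾`, `Ĥ⁽ⁿ⁾` with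
(1) `∑_v μ̂⁽ⁿ⁾_v Ĥ⁽ⁿ⁾_v = 1`, (2) `A_n μ̂⁽ⁿ⁺¹⁾ = λ_n μ̂⁽ⁿ⁾`, and
(3) `F_n Ĥ⁽ⁿ⁾ = λ_n Ĥ⁽ⁿ⁺¹⁾`. Conversely, for a generalized Bratteli diagram `B`
(its matrices `A_n` automatically have nonnegative integer entries, no zero rows or
columns, and finite column sums), if there are numbers `λ_n > 1`, nonnegative vectors
`μ̂⁽ⁿ⁾` and strictly positive vectors `Ĥ⁽ⁿ⁾` with `Ĥ⁽⁰⁾ ≡ 1` satisfying (1), (2), (3),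
then `B` possesses a tail-invariant probability measure whose value on a cylinder set
over a finite path of `n ≥ 1` edges with range `w ∈ V_n` is `μ̂⁽ⁿ⁾_w / (λ_0 ⋯ λ_{n-1})`,
and over the empty path at `w ∈ V_0` is `μ̂⁽⁰⁾_w`. -/
theorem tail_invariant_probability_measure_iff_eigen_sequences :
    (∀ B : GBD,
      (∀ (n : ℕ) (w : B.V n), ∃ e f : B.E n, e ≠ f ∧ B.src n e = w ∧ B.src n f = w) →
      ∀ μ : Measure B.Path, IsProbabilityMeasure μ → B.TailInvariant μ →
        (∀ w : B.V 0, 0 < μ {x : B.Path | B.src 0 (x.1 0) = w}) →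
        (∀ (n : ℕ) (p : B.FinPath n), 0 < μ (B.cyl p)) →
        ∃ (lam : ℕ → ℝ≥0∞) (mu : (n : ℕ) → B.V n → ℝ≥0∞) (H : (n : ℕ) → B.V n → ℝ≥0∞),
          (∀ n, 1 < lam n ∧ lam n ≠ ⊤) ∧
          (∀ (n : ℕ) (v : B.V n), mu n v ≠ ⊤) ∧
          (∀ (n : ℕ) (v : B.V n), H n v ≠ ⊤) ∧
          (∀ n : ℕ, ∑' v : B.V n, mu n v * H n v = 1) ∧
          (∀ (n : ℕ) (w : B.V n),
            ∑' v : B.V (n + 1), B.cnt n w v * mu (n + 1) v = lam n * mu n w) ∧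
          (∀ (n : ℕ) (v : B.V (n + 1)),
            ∑' w : B.V n, B.cnt n w v * H n w = lam n * H (n + 1) v)) ∧
    (∀ (B : GBD) (lam : ℕ → ℝ≥0∞) (mu : (n : ℕ) → B.V n → ℝ≥0∞)
        (H : (n : ℕ) → B.V n → ℝ≥0∞),
      (∀ n, 1 < lam n ∧ lam n ≠ ⊤) →
      (∀ (n : ℕ) (v : B.V n), mu n v ≠ ⊤) →
      (∀ (n : ℕ) (v : B.V n), 0 < H n v ∧ H n v ≠ ⊤) →
      (∀ v : B.V 0, H 0 v = 1) →
      (∀ n : ℕ, ∑' v : B.V n, mu n v * H n v = 1) →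
      (∀ (n : ℕ) (w : B.V n),
        ∑' v : B.V (n + 1), B.cnt n w v * mu (n + 1) v = lam n * mu n w) →
      (∀ (n : ℕ) (v : B.V (n + 1)),
        ∑' w : B.V n, B.cnt n w v * H n w = lam n * H (n + 1) v) →
      ∃ μ : Measure B.Path, B.TailInvariant μ ∧ IsProbabilityMeasure μ ∧
        (∀ w : B.V 0, μ {x : B.Path | B.src 0 (x.1 0) = w} = mu 0 w) ∧
        ∀ (n : ℕ) (p : B.FinPath n),
          μ (B.cyl p) = mu (n + 1) p.out / ∏ i ∈ Finset.range (n + 1), lam i) := by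
  refine ⟨fun B _ μ hp h _ _ => B.forward μ hp h, ?_⟩
  intro B lam mu H hl hmu _ hH0 h1 h2 _
  refine B.backward lam mu hl hmu ?_ h2
  simpa [hH0] using h1 0
end
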